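/- arXiv:2110.14741 — 4 statements merged into one kernel-verified Lean document; each statement's English description precedes it below -/
import Mathlib

section
/- Let α ∈ (0,2). Let X_1, X_2, … be independent identically distributed real random variables whose common distribution is symmetric about 0 and has a probability density function f satisfying f(u) ≍ u^{-1-α} as u → ∞. For n ∈ ℕ let S_n := X_1 + … + X_n, and for n ∈ ℕ, x > 0, c ∈ (0,1) define p_{1,1,+}(n,x,c) := P(S_n > x and there exists i ∈ {1,…,n} with X_i > x and max_{j ∈ {1,…,n}, j ≠ i} |X_j| ≤ c x). Then for any sequences (n_k) of positive integers, (x_k) of positive reals, and (c_k) in (0,1) with n_k / x_k^α → 0, (n_k x_k^{-α}) / c_k^{2α} → 0, and c_k → 0, one has P(S_{n_k} > x_k) ∼ p_{1,1,+}(n_k, x_k, c_k), i.e., the ratio of the two probabilities tends to 1 as k → ∞. -/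
open MeasureTheory ProbabilityTheory Filter

/-- Truncation at level `b`. -/
noncomputable def trunc1 (b u : ℝ) : ℝ := if |u| ≤ b then u else 0

lemma trunc1_measurable (b : ℝ) : Measurable (trunc1 b) := by
  unfold trunc1
  exact Measurable.ite (measurableSet_le measurable_id.abs measurable_const) measurable_id
    measurable_const

lemma trunc1_abs_le (b u : ℝ) (hb : 0 ≤ b) : |trunc1 b u| ≤ b := by
  unfold trunc1
  split_ifs with h
  · exact h
  · simpa using hb

lemma trunc1_neg (b u : ℝ) : trunc1 b (-u) = - trunc1 b u := by
  unfold trunc1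
  rw [abs_neg]
  split_ifs <;> simp

section dist

set_option linter.unusedSectionVars false

variable (ν : Measure ℝ) [IsProbabilityMeasure ν] (α : ℝ) (f : ℝ → ℝ)
  (k0 K0 u0 : ℝ)

lemma tail_upper (hα : 0 < α)
    (hpdf : ν = (volume : Measure ℝ).withDensity (fun u => ENNReal.ofReal (f u)))
    (hK0 : 0 < K0) (hu0 : 0 < u0)
    (htail : ∀ u, u0 ≤ u → f u ≤ K0 * u ^ (-1 - α)) (t : ℝ) (ht : u0 ≤ t) :
    ν.real (Set.Ioi t) ≤ K0 / α * t ^ (-α) := by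
  have ht0 : 0 < t := hu0.trans_le ht
  have hint : IntegrableOn (fun u : ℝ => K0 * u ^ (-1 - α)) (Set.Ioi t) :=
    (integrableOn_Ioi_rpow_of_lt (by linarith) ht0).const_mul K0
  have hval : ∫ u in Set.Ioi t, K0 * u ^ (-1 - α) = K0 / α * t ^ (-α) := by
    rw [integral_const_mul, integral_Ioi_rpow_of_lt (by linarith) ht0,
      show -1 - α + 1 = -α by ring]
    field_simp
  have h : ν (Set.Ioi t) ≤ ENNReal.ofReal (K0 / α * t ^ (-α)) := by
    rw [hpdf, withDensity_apply _ measurableSet_Ioi, ← hval,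
      ofReal_integral_eq_lintegral_ofReal hint]
    · apply setLIntegral_mono' measurableSet_Ioi
      intro u hu
      exact ENNReal.ofReal_le_ofReal (htail u (ht.trans (le_of_lt hu)))
    · filter_upwards [ae_restrict_mem measurableSet_Ioi] with u hu
      have : 0 < u := ht0.trans hu
      simp only [Pi.zero_apply]; positivity
  exact ENNReal.toReal_le_of_le_ofReal (by positivity) h

lemma tail_lower (hα : 0 < α)
    (hpdf : ν = (volume : Measure ℝ).withDensity (fun u => ENNReal.ofReal (f u)))
    (hk0 : 0 < k0) (hu0 : 0 < u0)
    (htail : ∀ u, u0 ≤ u → k0 * u ^ (-1 - α) ≤ f u) (t : ℝ) (ht : u0 ≤ t) :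
    k0 / α * t ^ (-α) ≤ ν.real (Set.Ioi t) := by
  have ht0 : 0 < t := hu0.trans_le ht
  have hint : IntegrableOn (fun u : ℝ => k0 * u ^ (-1 - α)) (Set.Ioi t) :=
    (integrableOn_Ioi_rpow_of_lt (by linarith) ht0).const_mul k0
  have hval : ∫ u in Set.Ioi t, k0 * u ^ (-1 - α) = k0 / α * t ^ (-α) := by
    rw [integral_const_mul, integral_Ioi_rpow_of_lt (by linarith) ht0,
      show -1 - α + 1 = -α by ring]
    field_simp
  have h : ENNReal.ofReal (k0 / α * t ^ (-α)) ≤ ν (Set.Ioi t) := by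
    rw [hpdf, withDensity_apply _ measurableSet_Ioi, ← hval,
      ofReal_integral_eq_lintegral_ofReal hint]
    · apply setLIntegral_mono' measurableSet_Ioi
      intro u hu
      exact ENNReal.ofReal_le_ofReal (htail u (ht.trans (le_of_lt hu)))
    · filter_upwards [ae_restrict_mem measurableSet_Ioi] with u hu
      have : 0 < u := ht0.trans hu
      simp only [Pi.zero_apply]; positivity
  exact (ENNReal.ofReal_le_iff_le_toReal (measure_ne_top _ _)).1 h

lemma abs_tail_upper (hα : 0 < α)
    (hpdf : ν = (volume : Measure ℝ).withDensity (fun u => ENNReal.ofReal (f u)))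
    (hsymm : ν.map (fun u => -u) = ν)
    (hK0 : 0 < K0) (hu0 : 0 < u0)
    (htail : ∀ u, u0 ≤ u → f u ≤ K0 * u ^ (-1 - α)) (t : ℝ) (ht : u0 ≤ t) :
    ν.real {u | t < |u|} ≤ 2 * (K0 / α) * t ^ (-α) := by
  have h1 := tail_upper ν α f K0 u0 hα hpdf hK0 hu0 htail t ht
  have h2 : ν.real ((fun u => -u) ⁻¹' (Set.Ioi t)) = ν.real (Set.Ioi t) := by
    conv_rhs => rw [← hsymm]
    rw [map_measureReal_apply measurable_neg measurableSet_Ioi]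
  have h3 : {u : ℝ | t < |u|} ⊆ Set.Ioi t ∪ ((fun u => -u) ⁻¹' (Set.Ioi t)) := by
    intro u hu
    rcases lt_abs.1 (show t < |u| from hu) with h | h
    · exact Or.inl h
    · exact Or.inr h
  have h4 := (measureReal_mono h3 (μ := ν)).trans (measureReal_union_le _ _)
  linarith

lemma window_upper (hα : 0 < α)
    (hpdf : ν = (volume : Measure ℝ).withDensity (fun u => ENNReal.ofReal (f u)))
    (hK0 : 0 < K0) (hu0 : 0 < u0)
    (htail : ∀ u, u0 ≤ u → f u ≤ K0 * u ^ (-1 - α)) (x δ : ℝ) (hx : u0 ≤ x / 2)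
    (hδ0 : 0 ≤ δ) (hδ : δ ≤ 1 / 2) :
    ν.real (Set.Ioc ((1 - δ) * x) x) ≤ K0 * 2 ^ (1 + α) * δ * x ^ (-α) := by
  have hx0 : 0 < x := by linarith
  have hlow : x / 2 ≤ (1 - δ) * x := by nlinarith
  have hc : K0 * (x / 2) ^ (-1 - α) * (δ * x) = K0 * 2 ^ (1 + α) * δ * x ^ (-α) := by
    rw [Real.div_rpow hx0.le (by norm_num), show -1 - α = -(1 + α) by ring,
      Real.rpow_neg (by norm_num : (0:ℝ) ≤ 2), show -(1 + α) = -α - 1 by ring,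
      Real.rpow_sub_one hx0.ne']
    field_simp
  have h : ν (Set.Ioc ((1 - δ) * x) x) ≤ ENNReal.ofReal (K0 * 2 ^ (1 + α) * δ * x ^ (-α)) := by
    rw [hpdf, withDensity_apply _ measurableSet_Ioc, ← hc, ENNReal.ofReal_mul (by positivity)]
    calc ∫⁻ a in Set.Ioc ((1 - δ) * x) x, ENNReal.ofReal (f a)
        ≤ ∫⁻ a in Set.Ioc ((1 - δ) * x) x, ENNReal.ofReal (K0 * (x / 2) ^ (-1 - α)) := by
          apply setLIntegral_mono' measurableSet_Ioc
          intro u hu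
          have h1 : x / 2 ≤ u := hlow.trans hu.1.le
          refine ENNReal.ofReal_le_ofReal ((htail u (hx.trans h1)).trans ?_)
          exact mul_le_mul_of_nonneg_left
            (Real.rpow_le_rpow_of_nonpos (by positivity) h1 (by linarith)) hK0.le
      _ = _ := by
          rw [setLIntegral_const, Real.volume_Ioc]
          congr 2; ring
  exact ENNReal.toReal_le_of_le_ofReal (by positivity) h

lemma trunc_mean (hsymm : ν.map (fun u => -u) = ν) (b : ℝ) :
    ∫ u, trunc1 b u ∂ν = 0 := by
  have h : ∫ u, trunc1 b u ∂ν = - ∫ u, trunc1 b u ∂ν := by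
    conv_lhs => rw [← hsymm]
    rw [integral_map measurable_neg.aemeasurable (trunc1_measurable b).aestronglyMeasurable]
    simp_rw [trunc1_neg]
    rw [integral_neg]
  linarith

lemma trunc_sq (hα : 0 < α) (hα2 : α < 2) (hfmeas : Measurable f)
    (hpdf : ν = (volume : Measure ℝ).withDensity (fun u => ENNReal.ofReal (f u)))
    (hsymm : ν.map (fun u => -u) = ν)
    (hK0 : 0 < K0) (hu0 : 0 < u0)
    (htail : ∀ u, u0 ≤ u → f u ≤ K0 * u ^ (-1 - α)) (t : ℝ) (ht : u0 ≤ t) :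
    ∫ u, (trunc1 t u) ^ 2 ∂ν ≤ (u0 ^ α + 2 * (K0 / (2 - α))) * t ^ (2 - α) := by
  have ht0 : 0 < t := hu0.trans_le ht
  have h2α : 0 < 2 - α := by linarith
  set G : ℝ → ENNReal := (Set.Ioc u0 t).indicator (fun u => ENNReal.ofReal (u ^ 2)) with hG
  have hGm : Measurable G :=
    (Measurable.ennreal_ofReal (measurable_id.pow_const 2)).indicator measurableSet_Ioc
  have hGi : ∫⁻ u, G u ∂ν ≤ ENNReal.ofReal (K0 / (2 - α) * t ^ (2 - α)) := by
    have hint : IntegrableOn (fun u : ℝ => K0 * u ^ (1 - α)) (Set.Ioc u0 t) := by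
      refine Integrable.const_mul ?_ K0
      refine ((intervalIntegral.intervalIntegrable_rpow (a := u0) (b := t) (r := 1 - α)
        (Or.inr ?_)).1)
      rw [Set.uIcc_of_le ht]
      intro h; exact absurd h.1 (not_le.2 hu0)
    have hval : ∫ u in Set.Ioc u0 t, K0 * u ^ (1 - α) ≤ K0 / (2 - α) * t ^ (2 - α) := by
      rw [integral_const_mul, ← intervalIntegral.integral_of_le ht,
        integral_rpow (Or.inl (by linarith)), show 1 - α + 1 = 2 - α by ring]
      have : 0 ≤ u0 ^ (2 - α) := by positivity
      rw [div_mul_eq_mul_div, ← mul_div_assoc]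
      gcongr
      linarith
    rw [hG, lintegral_indicator measurableSet_Ioc, hpdf,
      setLIntegral_withDensity_eq_setLIntegral_mul _ hfmeas.ennreal_ofReal
        (g := fun a => ENNReal.ofReal (a ^ 2))
        (Measurable.ennreal_ofReal (measurable_id.pow_const 2)) measurableSet_Ioc]
    refine le_trans ?_ (ENNReal.ofReal_le_ofReal hval)
    rw [ofReal_integral_eq_lintegral_ofReal hint]
    · apply setLIntegral_mono' measurableSet_Ioc
      intro u hu
      have hu' : 0 < u := hu0.trans hu.1
      simp only [Pi.mul_apply]
      rw [← ENNReal.ofReal_mul' (by positivity)]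
      apply ENNReal.ofReal_le_ofReal
      have h1 := mul_le_mul_of_nonneg_right (htail u hu.1.le) (sq_nonneg u)
      refine h1.trans (le_of_eq ?_)
      rw [mul_assoc, ← Real.rpow_natCast u 2, ← Real.rpow_add hu']
      norm_num
      left; congr 1; ring
    · filter_upwards [ae_restrict_mem measurableSet_Ioc] with u hu
      have : 0 < u := hu0.trans hu.1
      simp only [Pi.zero_apply]; positivity
  have hGn : ∫⁻ u, G (-u) ∂ν = ∫⁻ u, G u ∂ν := by
    conv_rhs => rw [← hsymm]
    rw [lintegral_map hGm measurable_neg]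
  have hpt : ∀ u, ENNReal.ofReal ((trunc1 t u) ^ 2) ≤ ENNReal.ofReal (u0 ^ 2) + (G u + G (-u)) := by
    intro u
    unfold trunc1
    split_ifs with h
    · rw [abs_le] at h
      by_cases h1 : u0 < u
      · have : G u = ENNReal.ofReal (u ^ 2) := Set.indicator_of_mem (show u ∈ Set.Ioc u0 t from ⟨h1, h.2⟩) _
        rw [this]
        exact le_add_left (le_add_right le_rfl)
      · by_cases h2 : u0 < -u
        · have : G (-u) = ENNReal.ofReal ((-u) ^ 2) :=
            Set.indicator_of_mem (show -u ∈ Set.Ioc u0 t from ⟨h2, by linarith⟩) _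
          rw [this, neg_sq]
          exact le_add_left (le_add_left le_rfl)
        · refine le_add_right (ENNReal.ofReal_le_ofReal ?_)
          apply sq_le_sq.2
          rw [abs_of_pos hu0, abs_le]
          constructor <;> linarith
    · simp
  have hu0t : u0 ^ 2 ≤ u0 ^ α * t ^ (2 - α) := by
    calc u0 ^ 2 = u0 ^ α * u0 ^ (2 - α) := by
          rw [← Real.rpow_add hu0]; norm_num
      _ ≤ _ := by gcongr
  have hL : ∫⁻ u, ENNReal.ofReal ((trunc1 t u) ^ 2) ∂ν ≤
      ENNReal.ofReal ((u0 ^ α + 2 * (K0 / (2 - α))) * t ^ (2 - α)) := by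
    calc _ ≤ ∫⁻ u, (ENNReal.ofReal (u0 ^ 2) + (G u + G (-u))) ∂ν := lintegral_mono hpt
      _ = ENNReal.ofReal (u0 ^ 2) + (∫⁻ u, G u ∂ν + ∫⁻ u, G u ∂ν) := by
          rw [lintegral_add_left measurable_const, lintegral_add_left hGm, hGn]
          simp
      _ ≤ ENNReal.ofReal (u0 ^ α * t ^ (2 - α)) + (ENNReal.ofReal (K0 / (2 - α) * t ^ (2 - α))
            + ENNReal.ofReal (K0 / (2 - α) * t ^ (2 - α))) := by
          gcongr
      _ = _ := by
          rw [← ENNReal.ofReal_add (by positivity) (by positivity),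
            ← ENNReal.ofReal_add (by positivity) (by positivity)]
          congr 1; ring
  rw [integral_eq_lintegral_of_nonneg_ae (ae_of_all _ fun u => sq_nonneg _)
    ((trunc1_measurable t).pow_const 2).aestronglyMeasurable]
  exact ENNReal.toReal_le_of_le_ofReal (by positivity) hL

end dist

section prob

set_option linter.unusedSectionVars false

variable {Ω : Type*} [MeasurableSpace Ω] (μ : Measure Ω) [IsProbabilityMeasure μ]
  (ν : Measure ℝ) [IsProbabilityMeasure ν] (X : ℕ → Ω → ℝ)

lemma cheb_trunc (hmeas : ∀ i, Measurable (X i)) (hindep : iIndepFun X μ)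
    (hX : ∀ i, μ.map (X i) = ν) (hsymm : ν.map (fun u => -u) = ν)
    (b v : ℝ) (hb : 0 ≤ b) (hv : ∫ u, (trunc1 b u) ^ 2 ∂ν ≤ v) (hv0 : 0 ≤ v)
    (s : Finset ℕ) (n : ℕ) (hs : s.card ≤ n) (a : ℝ) (ha : 0 < a) :
    μ.real {ω | a ≤ |∑ j ∈ s, trunc1 b (X j ω)|} ≤ n * v / a ^ 2 := by
  set Y : ℕ → Ω → ℝ := fun j ω => trunc1 b (X j ω) with hY
  have hYm : ∀ j, Measurable (Y j) := fun j => (trunc1_measurable b).comp (hmeas j)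
  have hLp : ∀ j, MemLp (Y j) 2 μ := fun j =>
    MemLp.of_bound (hYm j).aestronglyMeasurable b
      (ae_of_all _ fun ω => by rw [Real.norm_eq_abs]; exact trunc1_abs_le b _ hb)
  have hmean : ∀ j, ∫ ω, Y j ω ∂μ = 0 := fun j => by
    have := integral_map (μ := μ) (hmeas j).aemeasurable
      (f := trunc1 b) (trunc1_measurable b).aestronglyMeasurable
    rw [hX j, trunc_mean ν hsymm b] at this
    exact this.symm
  have hvar : ∀ j, Var[Y j; μ] ≤ v := fun j => by
    refine (variance_le_expectation_sq (hYm j).aestronglyMeasurable).trans ?_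
    have := integral_map (μ := μ) (hmeas j).aemeasurable
      (f := fun u => trunc1 b u ^ 2) ((trunc1_measurable b).pow_const 2).aestronglyMeasurable
    rw [hX j] at this
    simp only [Pi.pow_apply]
    rw [← this]; exact hv
  have hind : iIndepFun Y μ := hindep.comp (fun _ => trunc1 b) (fun _ => trunc1_measurable b)
  have hvs : Var[∑ j ∈ s, Y j; μ] ≤ n * v := by
    rw [IndepFun.variance_sum (fun i _ => hLp i) (fun i _ j _ hij => hind.indepFun hij)]
    calc ∑ j ∈ s, Var[Y j; μ] ≤ ∑ j ∈ s, v := Finset.sum_le_sum fun j _ => hvar j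
      _ = s.card * v := by simp
      _ ≤ n * v := by gcongr
  have hmem : MemLp (∑ j ∈ s, Y j) 2 μ := memLp_finsetSum' s fun i _ => hLp i
  have hms : ∫ ω, (∑ j ∈ s, Y j) ω ∂μ = 0 := by
    simp only [Finset.sum_apply]
    rw [integral_finsetSum _ fun j _ => (hLp j).integrable (by norm_num)]
    simp [hmean]
  have hch := meas_ge_le_variance_div_sq hmem ha
  rw [hms] at hch
  simp only [sub_zero, Finset.sum_apply] at hch
  refine ENNReal.toReal_le_of_le_ofReal (by positivity) (hch.trans ?_)
  apply ENNReal.ofReal_le_ofReal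
  gcongr

lemma indep_split (hmeas : ∀ i, Measurable (X i)) (hindep : iIndepFun X μ)
    (i : ℕ) (s : Finset ℕ) (his : i ∉ s) (A : Set ℝ) (hA : MeasurableSet A)
    (B : Set (s → ℝ)) (hB : MeasurableSet B) :
    μ.real ({ω | X i ω ∈ A} ∩ {ω | (fun j : s => X j ω) ∈ B}) =
      μ.real {ω | X i ω ∈ A} * μ.real {ω | (fun j : s => X j ω) ∈ B} := by
  have h := hindep.indepFun_finset {i} s (by simpa using his) hmeas
  have h2 : IndepFun (X i) (fun ω (j : s) => X j ω) μ :=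
    h.comp (φ := fun y : (({i} : Finset ℕ) → ℝ) => y ⟨i, by simp⟩) (ψ := id)
      (measurable_pi_apply _) measurable_id
  have h3 := h2.measure_inter_preimage_eq_mul A B hA hB
  unfold Measure.real
  rw [← ENNReal.toReal_mul]
  exact congrArg ENNReal.toReal h3

lemma map_real (hmeas : ∀ i, Measurable (X i)) (hX : ∀ i, μ.map (X i) = ν)
    (i : ℕ) (A : Set ℝ) (hA : MeasurableSet A) : μ.real {ω | X i ω ∈ A} = ν.real A := by
  rw [← hX i, map_measureReal_apply (hmeas i) hA]; rfl

lemma sum_eq_trunc (s : Finset ℕ) (b : ℝ) (y : ℕ → ℝ) (h : ∀ j ∈ s, |y j| ≤ b) :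
    ∑ j ∈ s, trunc1 b (y j) = ∑ j ∈ s, y j := by
  refine Finset.sum_congr rfl fun j hj => ?_
  simp [trunc1, h j hj]

lemma trunc_sum_meas (b : ℝ) (s : Finset ℕ) :
    Measurable (fun y : s → ℝ => ∑ j, trunc1 b (y j)) :=
  Finset.measurable_sum _ fun j _ => (trunc1_measurable b).comp (measurable_pi_apply j)

/-- the event in the statement -/
def evQ (n : ℕ) (x b : ℝ) : Set Ω :=
  {ω | (∑ i ∈ Finset.range n, X i ω) > x ∧ ∃ i ∈ Finset.range n, X i ω > x ∧
    ∀ j ∈ Finset.range n, j ≠ i → |X j ω| ≤ b}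

lemma upper_bound (hmeas : ∀ i, Measurable (X i)) (hindep : iIndepFun X μ)
    (hX : ∀ i, μ.map (X i) = ν) (hsymm : ν.map (fun u => -u) = ν)
    (n : ℕ) (x b δ g v w : ℝ) (hb : 0 ≤ b) (hx : 0 < x) (hδ : 0 < δ)
    (hg : ν.real {u | b < |u|} ≤ g)
    (hv : ∫ u, (trunc1 b u) ^ 2 ∂ν ≤ v) (hv0 : 0 ≤ v)
    (hw : ν.real (Set.Ioc ((1 - δ) * x) x) ≤ w) :
    μ.real {ω | (∑ i ∈ Finset.range n, X i ω) > x} ≤ μ.real (evQ X n x b) +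
      (n ^ 2 * g ^ 2 + n * v / x ^ 2 + n * (g * (n * v / (δ * x) ^ 2)) + n * w) := by
  classical
  have hg0 : 0 ≤ g := measureReal_nonneg.trans hg
  have hbm : MeasurableSet {u : ℝ | b < |u|} := measurableSet_lt measurable_const measurable_id.abs
  set V : ℕ → Set Ω := fun i => {ω | X i ω ∈ {u : ℝ | b < |u|}} ∩
    {ω | (fun j : (Finset.range n).erase i => X j ω) ∈
      {y : (Finset.range n).erase i → ℝ | δ * x ≤ |∑ j, trunc1 b (y j)|}} with hVdef
  set W : ℕ → Set Ω := fun i => {ω | X i ω ∈ Set.Ioc ((1 - δ) * x) x} with hWdef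
  set U0 : Set Ω := {ω | x ≤ |∑ j ∈ Finset.range n, trunc1 b (X j ω)|} with hU0def
  set Z : ℕ × ℕ → Set Ω := fun p => {ω | X p.1 ω ∈ {u : ℝ | b < |u|}} ∩
    {ω | (fun j : ({p.2} : Finset ℕ) => X j ω) ∈
      {y : ({p.2} : Finset ℕ) → ℝ | b < |y ⟨p.2, by simp⟩|}} with hZdef
  set F := (Finset.range n ×ˢ Finset.range n).filter (fun p => p.1 ≠ p.2) with hF
  have hsub : {ω | (∑ i ∈ Finset.range n, X i ω) > x} ⊆ evQ X n x b ∪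
      ((⋃ p ∈ F, Z p) ∪ U0 ∪ (⋃ i ∈ Finset.range n, V i) ∪ (⋃ i ∈ Finset.range n, W i)) := by
    intro ω hω
    have hω' : x < ∑ i ∈ Finset.range n, X i ω := hω
    by_contra hcon
    simp only [Set.mem_union, Set.mem_iUnion, not_or, not_exists] at hcon
    obtain ⟨hQ, ⟨⟨hZ, hU⟩, hV⟩, hW⟩ := hcon
    by_cases hall : ∀ j ∈ Finset.range n, |X j ω| ≤ b
    · apply hU
      rw [hU0def, Set.mem_ofPred_eq, sum_eq_trunc _ b (fun j => X j ω) hall]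
      exact hω'.le.trans (le_abs_self _)
    · push Not at hall
      obtain ⟨i, hi, hib⟩ := hall
      have hoth : ∀ j ∈ Finset.range n, j ≠ i → |X j ω| ≤ b := by
        intro j hj hji
        by_contra hjb
        push Not at hjb
        exact hZ (i, j) (by simp [hF, hji.symm, Finset.mem_range.1 hi, Finset.mem_range.1 hj])
          ⟨hib, hjb⟩
      have hix : X i ω ≤ x := by
        by_contra h
        push Not at h
        exact hQ ⟨hω, i, hi, h, hoth⟩
      have hiw : X i ω ≤ (1 - δ) * x := by
        by_contra h
        push Not at h
        exact hW i hi ⟨h, hix⟩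
      apply hV i hi
      refine ⟨hib, ?_⟩
      simp only [Set.mem_ofPred_eq]
      rw [Finset.sum_coe_sort ((Finset.range n).erase i) (fun j => trunc1 b (X j ω)),
        sum_eq_trunc _ b (fun j => X j ω)
          (fun j hj => hoth j (Finset.mem_of_mem_erase hj) (Finset.ne_of_mem_erase hj))]
      refine le_trans ?_ (le_abs_self _)
      have := Finset.add_sum_erase (Finset.range n) (fun j => X j ω) hi
      linarith
  have hXb : ∀ i, μ.real {ω | X i ω ∈ {u : ℝ | b < |u|}} ≤ g := fun i => by
    rw [map_real μ ν X hmeas hX i _ hbm]; exact hg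
  have bZ : μ.real (⋃ p ∈ F, Z p) ≤ n ^ 2 * g ^ 2 := by
    refine (measureReal_biUnion_finset_le _ _).trans ?_
    calc ∑ p ∈ F, μ.real (Z p) ≤ ∑ p ∈ F, g ^ 2 := by
          refine Finset.sum_le_sum fun p hp => ?_
          have hne : p.1 ≠ p.2 := (Finset.mem_filter.1 hp).2
          rw [hZdef]
          simp only
          rw [indep_split μ X hmeas hindep p.1 {p.2} (by simpa using hne) _ hbm _
            (measurableSet_lt measurable_const (measurable_pi_apply _).abs), sq]
          exact mul_le_mul (hXb _) (hXb p.2) measureReal_nonneg hg0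
      _ = F.card * g ^ 2 := by simp
      _ ≤ n ^ 2 * g ^ 2 := by
          gcongr
          have : F.card ≤ n * n := (Finset.card_filter_le _ _).trans (by simp)
          rw [sq]; exact_mod_cast this
  have bU : μ.real U0 ≤ n * v / x ^ 2 :=
    cheb_trunc μ ν X hmeas hindep hX hsymm b v hb hv hv0 _ n (by simp) x hx
  have bV : μ.real (⋃ i ∈ Finset.range n, V i) ≤ n * (g * (n * v / (δ * x) ^ 2)) := by
    refine (measureReal_biUnion_finset_le _ _).trans ?_
    calc ∑ i ∈ Finset.range n, μ.real (V i)
        ≤ ∑ i ∈ Finset.range n, (g * (n * v / (δ * x) ^ 2)) := by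
          refine Finset.sum_le_sum fun i hi => ?_
          rw [hVdef]
          simp only
          rw [indep_split μ X hmeas hindep i _ (by simp) _ hbm _
            (measurableSet_le measurable_const (trunc_sum_meas b _).abs)]
          refine mul_le_mul (hXb _) ?_ measureReal_nonneg hg0
          have := cheb_trunc μ ν X hmeas hindep hX hsymm b v hb hv hv0 ((Finset.range n).erase i) n
            ((Finset.card_erase_le).trans (by simp)) (δ * x) (by positivity)
          refine le_trans (le_of_eq ?_) this
          congr 1
          ext ω
          simp only [Set.mem_ofPred_eq]
          rw [Finset.sum_coe_sort ((Finset.range n).erase i) (fun j => trunc1 b (X j ω))]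
      _ = _ := by simp
  have bW : μ.real (⋃ i ∈ Finset.range n, W i) ≤ n * w := by
    refine (measureReal_biUnion_finset_le _ _).trans ?_
    calc ∑ i ∈ Finset.range n, μ.real (W i) ≤ ∑ i ∈ Finset.range n, w := by
          refine Finset.sum_le_sum fun i hi => ?_
          rw [hWdef]
          simp only
          rw [map_real μ ν X hmeas hX i _ measurableSet_Ioc]; exact hw
      _ = _ := by simp
  have h0 := measureReal_mono hsub (μ := μ)
  have h1 := measureReal_union_le (μ := μ) (evQ X n x b)
    ((⋃ p ∈ F, Z p) ∪ U0 ∪ (⋃ i ∈ Finset.range n, V i) ∪ (⋃ i ∈ Finset.range n, W i))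
  have h2 := measureReal_union_le (μ := μ)
    ((⋃ p ∈ F, Z p) ∪ U0 ∪ (⋃ i ∈ Finset.range n, V i)) (⋃ i ∈ Finset.range n, W i)
  have h3 := measureReal_union_le (μ := μ)
    ((⋃ p ∈ F, Z p) ∪ U0) (⋃ i ∈ Finset.range n, V i)
  have h4 := measureReal_union_le (μ := μ) (⋃ p ∈ F, Z p) U0
  linarith

lemma lower_bound (hmeas : ∀ i, Measurable (X i)) (hindep : iIndepFun X μ)
    (hX : ∀ i, μ.map (X i) = ν) (hsymm : ν.map (fun u => -u) = ν)
    (n : ℕ) (x b g v l : ℝ) (hb : 0 ≤ b) (hbx : b < x) (hx : 0 < x)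
    (hg : ν.real {u | b < |u|} ≤ g)
    (hv : ∫ u, (trunc1 b u) ^ 2 ∂ν ≤ v) (hv0 : 0 ≤ v)
    (hl0 : 0 ≤ l) (hl : l ≤ ν.real (Set.Ioi (2 * x))) :
    n * (l * (1 - n * g - n * v / x ^ 2)) ≤ μ.real (evQ X n x b) := by
  classical
  have hg0 : 0 ≤ g := measureReal_nonneg.trans hg
  have hbm : MeasurableSet {u : ℝ | b < |u|} := measurableSet_lt measurable_const measurable_id.abs
  have hXb : ∀ i, μ.real {ω | X i ω ∈ {u : ℝ | b < |u|}} ≤ g := fun i => by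
    rw [map_real μ ν X hmeas hX i _ hbm]; exact hg
  set B : (i : ℕ) → Set ((Finset.range n).erase i → ℝ) := fun i =>
    {y | (∀ j, |y j| ≤ b) ∧ |∑ j, trunc1 b (y j)| < x} with hBdef
  have hBm : ∀ i, MeasurableSet (B i) := fun i => by
    refine MeasurableSet.inter ?_ (measurableSet_lt (trunc_sum_meas b _).abs measurable_const)
    change MeasurableSet {y : (Finset.range n).erase i → ℝ | ∀ j, |y j| ≤ b}
    rw [Set.ofPred_forall]
    exact MeasurableSet.iInter fun j =>
      measurableSet_le (measurable_pi_apply j).abs measurable_const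
  set R : ℕ → Set Ω := fun i => {ω | X i ω ∈ Set.Ioi (2 * x)} ∩
    {ω | (fun j : (Finset.range n).erase i => X j ω) ∈ B i} with hRdef
  have htm : ∀ i, Measurable (fun ω => (fun j : (Finset.range n).erase i => X j ω)) := fun i =>
    measurable_pi_lambda _ fun j => hmeas j
  have hRm : ∀ i, MeasurableSet (R i) := fun i =>
    ((hmeas i) measurableSet_Ioi).inter ((htm i) (hBm i))
  have hsub : (⋃ i ∈ Finset.range n, R i) ⊆ evQ X n x b := by
    intro ω hω
    simp only [Set.mem_iUnion] at hω
    obtain ⟨i, hi, h1, h2, h3⟩ := hω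
    have h1' : 2 * x < X i ω := h1
    have hoth : ∀ j ∈ Finset.range n, j ≠ i → |X j ω| ≤ b := fun j hj hji =>
      h2 ⟨j, Finset.mem_erase.2 ⟨hji, hj⟩⟩
    refine ⟨?_, i, hi, by linarith, hoth⟩
    rw [Finset.sum_coe_sort ((Finset.range n).erase i) (fun j => trunc1 b (X j ω)),
        sum_eq_trunc _ b (fun j => X j ω)
          (fun j hj => hoth j (Finset.mem_of_mem_erase hj) (Finset.ne_of_mem_erase hj))] at h3
    have := Finset.add_sum_erase (Finset.range n) (fun j => X j ω) hi
    have := (abs_lt.1 h3).1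
    change x < _
    linarith
  have hdisj : (↑(Finset.range n) : Set ℕ).PairwiseDisjoint R := by
    intro i hi j hj hij
    refine Set.disjoint_left.2 fun ω h1 h2 => ?_
    have h3 : 2 * x < X i ω := h1.1
    have h4 : |X i ω| ≤ b := h2.2.1 ⟨i, Finset.mem_erase.2 ⟨hij, hi⟩⟩
    have := le_abs_self (X i ω)
    linarith
  have hRl : ∀ i ∈ Finset.range n, l * (1 - n * g - n * v / x ^ 2) ≤ μ.real (R i) := by
    intro i hi
    rw [hRdef]
    simp only
    rw [indep_split μ X hmeas hindep i _ (by simp) _ measurableSet_Ioi _ (hBm i),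
      map_real μ ν X hmeas hX i _ measurableSet_Ioi]
    have hB1 : 1 - n * g - n * v / x ^ 2 ≤
        μ.real {ω | (fun j : (Finset.range n).erase i => X j ω) ∈ B i} := by
      have hcov : (Set.univ : Set Ω) ⊆
          {ω | (fun j : (Finset.range n).erase i => X j ω) ∈ B i} ∪
          ((⋃ j ∈ Finset.range n, {ω | X j ω ∈ {u : ℝ | b < |u|}}) ∪
            {ω | x ≤ |∑ j ∈ (Finset.range n).erase i, trunc1 b (X j ω)|}) := by
        intro ω _
        by_contra hcon
        simp only [Set.mem_union, Set.mem_iUnion, not_or, not_exists] at hcon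
        obtain ⟨h1, h2, h3⟩ := hcon
        apply h1
        refine ⟨fun j => ?_, ?_⟩
        · by_contra h
          push Not at h
          exact h2 j (Finset.mem_of_mem_erase j.2) h
        · rw [Finset.sum_coe_sort ((Finset.range n).erase i) (fun j => trunc1 b (X j ω))]
          by_contra h
          push Not at h
          exact h3 h
      have h0 := measureReal_mono hcov (μ := μ)
      have h1 := measureReal_union_le (μ := μ)
        {ω | (fun j : (Finset.range n).erase i => X j ω) ∈ B i}
        ((⋃ j ∈ Finset.range n, {ω | X j ω ∈ {u : ℝ | b < |u|}}) ∪
            {ω | x ≤ |∑ j ∈ (Finset.range n).erase i, trunc1 b (X j ω)|})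
      have h2 := measureReal_union_le (μ := μ)
        (⋃ j ∈ Finset.range n, {ω | X j ω ∈ {u : ℝ | b < |u|}})
            {ω | x ≤ |∑ j ∈ (Finset.range n).erase i, trunc1 b (X j ω)|}
      have h3 := cheb_trunc μ ν X hmeas hindep hX hsymm b v hb hv hv0 ((Finset.range n).erase i) n
            ((Finset.card_erase_le).trans (by simp)) x hx
      have h4 : μ.real (⋃ j ∈ Finset.range n, {ω | X j ω ∈ {u : ℝ | b < |u|}}) ≤ n * g := by
        refine (measureReal_biUnion_finset_le _ _).trans ?_
        refine (Finset.sum_le_sum fun j _ => hXb j).trans ?_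
        simp
      rw [probReal_univ] at h0
      linarith
    calc l * (1 - n * g - n * v / x ^ 2) ≤
        l * μ.real {ω | (fun j : (Finset.range n).erase i => X j ω) ∈ B i} := by gcongr
      _ ≤ _ := by gcongr
  calc n * (l * (1 - n * g - n * v / x ^ 2)) =
      ∑ i ∈ Finset.range n, (l * (1 - n * g - n * v / x ^ 2)) := by simp
    _ ≤ ∑ i ∈ Finset.range n, μ.real (R i) := Finset.sum_le_sum hRl
    _ = μ.real (⋃ i ∈ Finset.range n, R i) :=
        (measureReal_biUnion_finset hdisj fun i _ => hRm i).symm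
    _ ≤ _ := measureReal_mono hsub

end prob

lemma ratio_bound (nn p q c x A B D K δ r E Q : ℝ) (hnn : 0 < nn) (hp : 0 < p) (hq : 0 < q)
    (hq1 : q ≤ 1) (hc : 0 < c) (hc1 : c ≤ 1) (hx : 0 < x) (hA : 0 < A) (hB : 0 < B) (hD : 0 < D)
    (hδ : 0 < δ) (hr : r = nn * p / q ^ 2) (hr1 : (2 * A + D) * r < 1)
    (hQE : Q ≤ E)
    (hE : E ≤ Q + (nn ^ 2 * (2 * A * (p / q)) ^ 2 + nn * (D * (c ^ 2 * x ^ 2 * p / q)) / x ^ 2 +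
      nn * (2 * A * (p / q) * (nn * (D * (c ^ 2 * x ^ 2 * p / q)) / (δ * x) ^ 2)) +
      nn * (K * δ * p)))
    (hQ : nn * (B * p * (1 - nn * (2 * A * (p / q)) - nn * (D * (c ^ 2 * x ^ 2 * p / q)) / x ^ 2))
      ≤ Q) :
    1 ≤ E / Q ∧ E / Q ≤ 1 + (4 * A ^ 2 * r + D * (c ^ 2 / q) + 2 * A * D * (r / δ ^ 2) + K * δ) /
      (B * (1 - (2 * A + D) * r)) := by
  have hr0 : 0 < r := by rw [hr]; positivity
  have e1 : nn ^ 2 * (2 * A * (p / q)) ^ 2 = nn * p * (4 * A ^ 2 * r) := by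
    rw [hr]; field_simp; ring
  have e2 : nn * (D * (c ^ 2 * x ^ 2 * p / q)) / x ^ 2 = nn * p * (D * (c ^ 2 / q)) := by
    field_simp
  have e3 : nn * (2 * A * (p / q) * (nn * (D * (c ^ 2 * x ^ 2 * p / q)) / (δ * x) ^ 2)) =
      nn * p * (2 * A * D * (r / δ ^ 2)) * c ^ 2 := by
    rw [hr]; field_simp
  have hc2 : c ^ 2 ≤ 1 := pow_le_one₀ hc.le hc1
  have e3' : nn * p * (2 * A * D * (r / δ ^ 2)) * c ^ 2 ≤ nn * p * (2 * A * D * (r / δ ^ 2)) :=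
    mul_le_of_le_one_right (by positivity) hc2
  have e4 : nn * (2 * A * (p / q)) = 2 * A * r * q := by rw [hr]; field_simp
  have e5 : nn * (D * (c ^ 2 * x ^ 2 * p / q)) / x ^ 2 = D * r * (q * c ^ 2) := by
    rw [hr]; field_simp
  have e4' : 2 * A * r * q ≤ 2 * A * r := mul_le_of_le_one_right (by positivity) hq1
  have e5' : D * r * (q * c ^ 2) ≤ D * r :=
    mul_le_of_le_one_right (by positivity) (mul_le_one₀ hq1 (by positivity) hc2)
  have hpos : 0 < B * (1 - (2 * A + D) * r) := mul_pos hB (by linarith)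
  have hQ' : nn * p * (B * (1 - (2 * A + D) * r)) ≤ Q := by
    refine le_trans ?_ hQ
    rw [e4, e5]
    have : B * (1 - (2 * A + D) * r) ≤ B * (1 - 2 * A * r * q - D * r * (q * c ^ 2)) :=
      mul_le_mul_of_nonneg_left (by linarith) hB.le
    calc _ ≤ nn * p * (B * (1 - 2 * A * r * q - D * r * (q * c ^ 2))) := by gcongr
      _ = _ := by ring
  have hQ0 : 0 < Q := lt_of_lt_of_le (by positivity) hQ'
  refine ⟨(one_le_div hQ0).2 hQE, ?_⟩
  set e := 4 * A ^ 2 * r + D * (c ^ 2 / q) + 2 * A * D * (r / δ ^ 2) + K * δ with he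
  have hE' : E - Q ≤ nn * p * e := by
    rw [e1, e2, e3] at hE
    rw [he]
    linarith
  have hm : 0 < nn * p := by positivity
  have he0 : 0 ≤ e := by
    have : 0 ≤ nn * p * e := by linarith
    exact nonneg_of_mul_nonneg_right this hm
  have : E / Q = 1 + (E - Q) / Q := by field_simp; ring
  rw [this]
  gcongr 1 + ?_
  rw [div_le_div_iff₀ hQ0 hpos]
  calc (E - Q) * (B * (1 - (2 * A + D) * r)) ≤ nn * p * e * (B * (1 - (2 * A + D) * r)) := by
        gcongr
    _ = e * (nn * p * (B * (1 - (2 * A + D) * r))) := by ring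
    _ ≤ e * Q := by gcongr

theorem p_one_one_plus_equiv
    {Ω : Type*} [MeasureSpace Ω] [IsProbabilityMeasure (ℙ : Measure Ω)]
    (α : ℝ) (hα : α ∈ Set.Ioo (0 : ℝ) 2)
    (X : ℕ → Ω → ℝ) (hmeas : ∀ i, Measurable (X i))
    (hindep : iIndepFun X ℙ)
    (hident : ∀ i, IdentDistrib (X i) (X 0) ℙ ℙ)
    (hsymm : Measure.map (X 0) ℙ = Measure.map (fun ω => -(X 0 ω)) ℙ)
    (f : ℝ → ℝ) (hf0 : ∀ u, 0 ≤ f u) (hfmeas : Measurable f)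
    (hpdf : Measure.map (X 0) ℙ = (volume : Measure ℝ).withDensity (fun u => ENNReal.ofReal (f u)))
    (k0 K0 u0 : ℝ) (hk0 : 0 < k0) (hK0 : k0 ≤ K0) (hu0 : 0 < u0)
    (htail : ∀ u, u0 ≤ u → k0 * u ^ (-1 - α) ≤ f u ∧ f u ≤ K0 * u ^ (-1 - α))
    (n : ℕ → ℕ) (hn : ∀ k, 0 < n k)
    (x : ℕ → ℝ) (hx : ∀ k, 0 < x k)
    (c : ℕ → ℝ) (hc : ∀ k, c k ∈ Set.Ioo (0 : ℝ) 1)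
    (hLD : Tendsto (fun k => (n k : ℝ) / x k ^ α) atTop (nhds 0))
    (hcc : Tendsto (fun k => (n k : ℝ) * x k ^ (-α) / c k ^ (2 * α)) atTop (nhds 0))
    (hc0 : Tendsto c atTop (nhds 0))
:
    Tendsto (fun k => (ℙ {ω | (∑ i ∈ Finset.range (n k), X i ω) > x k}).toReal / (ℙ {ω | (∑ i ∈ Finset.range (n k), X i ω) > x k ∧ ∃ i ∈ Finset.range (n k), X i ω > x k ∧ ∀ j ∈ Finset.range (n k), j ≠ i → |X j ω| ≤ c k * x k}).toReal) atTop (nhds 1) := by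
  obtain ⟨hα0, hα2⟩ := hα
  have hK0p : 0 < K0 := hk0.trans_le hK0
  have h2α : 0 < 2 - α := by linarith
  set ν : Measure ℝ := Measure.map (X 0) ℙ with hν
  haveI : IsProbabilityMeasure ν := Measure.isProbabilityMeasure_map (hmeas 0).aemeasurable
  have hX : ∀ i, Measure.map (X i) ℙ = ν := fun i => (hident i).map_eq
  have hsym : ν.map (fun u => -u) = ν := by
    conv_rhs => rw [hsymm]
    rw [hν, Measure.map_map measurable_neg (hmeas 0)]
    rfl
  set A := K0 / α with hA
  set B := k0 / α * 2 ^ (-α) with hB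
  set D := u0 ^ α + 2 * (K0 / (2 - α)) with hD
  set K := K0 * 2 ^ (1 + α) with hK
  have hAp : 0 < A := by positivity
  have hBp : 0 < B := by positivity
  have hDp : 0 < D := by positivity
  set r : ℕ → ℝ := fun k => (n k : ℝ) * x k ^ (-α) / c k ^ (2 * α) with hr
  have hr0 : ∀ k, 0 < r k := fun k => by
    have h1 : (0 : ℝ) < n k := by exact_mod_cast hn k
    have h2 := hx k
    have h3 := (hc k).1
    rw [hr]; positivity
  have hupper : Tendsto (fun k => 1 + (4 * A ^ 2 * r k + D * (c k ^ (2 - α)) +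
      2 * A * D * √(r k) + K * √√(r k)) / (B * (1 - (2 * A + D) * r k))) atTop (nhds 1) := by
    have hs : Tendsto (fun k => √(r k)) atTop (nhds 0) := by
      have := hcc.sqrt
      rwa [Real.sqrt_zero] at this
    have hss : Tendsto (fun k => √√(r k)) atTop (nhds 0) := by
      have := hs.sqrt
      rwa [Real.sqrt_zero] at this
    have hcp : Tendsto (fun k => c k ^ (2 - α)) atTop (nhds 0) := by
      have := hc0.rpow_const (p := 2 - α) (Or.inr h2α.le)
      rwa [Real.zero_rpow h2α.ne'] at this
    have h1 := (((hcc.const_mul (4 * A ^ 2)).add (hcp.const_mul D)).add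
      (hs.const_mul (2 * A * D))).add (hss.const_mul K)
    have h2 := ((hcc.const_mul (2 * A + D)).const_sub 1).const_mul B
    have h3 := (h1.div h2 (by simpa using hBp.ne')).const_add 1
    simpa using h3
  have ev1 : ∀ᶠ k in atTop, r k < (2 * u0) ^ (-α) := hcc.eventually_lt_const (by positivity)
  have ev2 : ∀ᶠ k in atTop, r k < 1 / 16 := hcc.eventually_lt_const (by norm_num)
  have ev3 : ∀ᶠ k in atTop, r k < 1 / (2 * A + D) := hcc.eventually_lt_const (by positivity)
  have key : ∀ᶠ k in atTop, 1 ≤ (ℙ {ω | (∑ i ∈ Finset.range (n k), X i ω) > x k}).toReal / (ℙ {ω | (∑ i ∈ Finset.range (n k), X i ω) > x k ∧ ∃ i ∈ Finset.range (n k), X i ω > x k ∧ ∀ j ∈ Finset.range (n k), j ≠ i → |X j ω| ≤ c k * x k}).toReal ∧ (ℙ {ω | (∑ i ∈ Finset.range (n k), X i ω) > x k}).toReal / (ℙ {ω | (∑ i ∈ Finset.range (n k), X i ω) > x k ∧ ∃ i ∈ Finset.range (n k), X i ω > x k ∧ ∀ j ∈ Finset.range (n k), j ≠ i → |X j ω|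 ≤ c k * x k}).toReal ≤ 1 + (4 * A ^ 2 * r k + D * (c k ^ (2 - α)) +
      2 * A * D * √(r k) + K * √√(r k)) / (B * (1 - (2 * A + D) * r k)) := by
    filter_upwards [ev1, ev2, ev3] with k h1 h2 h3
    have hnk : (1 : ℝ) ≤ n k := by exact_mod_cast hn k
    have hn0 : (0 : ℝ) < n k := by linarith
    have hxk := hx k
    obtain ⟨hck, hck1⟩ := hc k
    have hrk := hr0 k
    have hp : 0 < x k ^ (-α) := by positivity
    have hq : 0 < c k ^ α := by positivity
    have hq1 : c k ^ α ≤ 1 := Real.rpow_le_one hck.le hck1.le hα0.le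
    have eq2 : c k ^ (2 * α) = (c k ^ α) ^ 2 := by
      rw [mul_comm, Real.rpow_mul hck.le]; norm_num
    have eq1 : (c k * x k) ^ (-α) = x k ^ (-α) / c k ^ α := by
      rw [Real.mul_rpow hck.le hxk.le, Real.rpow_neg hck.le]; field_simp
    have eqc : c k ^ (2 - α) = c k ^ 2 / c k ^ α := by
      rw [Real.rpow_sub hck]; norm_num
    have eq3 : (c k * x k) ^ (2 - α) = c k ^ 2 * x k ^ 2 * x k ^ (-α) / c k ^ α := by
      rw [Real.mul_rpow hck.le hxk.le, eqc, show (2 - α) = 2 + -α by ring, Real.rpow_add hxk]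
      norm_num
      ring
    have hrdef : r k = n k * x k ^ (-α) / (c k ^ α) ^ 2 := by rw [hr]; simp only; rw [eq2]
    have hb : 2 * u0 ≤ c k * x k := by
      by_contra hcon
      push Not at hcon
      have h5 : (2 * u0) ^ (-α) ≤ (c k * x k) ^ (-α) :=
        Real.rpow_le_rpow_of_nonpos (by positivity) hcon.le (by linarith)
      have h6 : (c k * x k) ^ (-α) ≤ r k := by
        rw [eq1, hrdef, div_le_div_iff₀ hq (by positivity)]
        calc x k ^ (-α) * (c k ^ α) ^ 2 = (1 * c k ^ α) * (x k ^ (-α) * c k ^ α) := by ring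
          _ ≤ (n k * 1) * (x k ^ (-α) * c k ^ α) := by gcongr
          _ = _ := by ring
      linarith
    have hbx : c k * x k < x k := by nlinarith
    have hδ : √√(r k) ≤ 1 / 2 := by
      rw [Real.sqrt_le_left (by norm_num), Real.sqrt_le_left (by norm_num)]
      norm_num; linarith
    have hδ0 : 0 < √√(r k) := Real.sqrt_pos.2 (Real.sqrt_pos.2 hrk)
    have hup : ∀ u, u0 ≤ u → f u ≤ K0 * u ^ (-1 - α) := fun u hu => (htail u hu).2
    have hlo : ∀ u, u0 ≤ u → k0 * u ^ (-1 - α) ≤ f u := fun u hu => (htail u hu).1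
    have hg := abs_tail_upper ν α f K0 u0 hα0 hpdf hsym hK0p hu0 hup (c k * x k) (by linarith)
    have hv := trunc_sq ν α f K0 u0 hα0 hα2 hfmeas hpdf hsym hK0p hu0 hup (c k * x k) (by linarith)
    have hw := window_upper ν α f K0 u0 hα0 hpdf hK0p hu0 hup (x k) √√(r k) (by linarith) hδ0.le hδ
    have hl := tail_lower ν α f k0 u0 hα0 hpdf hk0 hu0 hlo (2 * x k) (by linarith)
    have hl' : B * x k ^ (-α) ≤ ν.real (Set.Ioi (2 * x k)) := by
      refine le_trans (le_of_eq ?_) hl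
      rw [Real.mul_rpow (by norm_num) hxk.le, hB]; ring
    rw [← hA, eq1] at hg
    rw [← hD, eq3] at hv
    rw [← hK] at hw
    have hv0 : 0 ≤ D * (c k ^ 2 * x k ^ 2 * x k ^ (-α) / c k ^ α) := by positivity
    have U := upper_bound ℙ ν X hmeas hindep hX hsym (n k) (x k) (c k * x k) √√(r k) _ _ _
      (by positivity) hxk hδ0 hg hv hv0 hw
    have Lo := lower_bound ℙ ν X hmeas hindep hX hsym (n k) (x k) (c k * x k) _ _ _
      (by positivity) hbx hxk hg hv hv0 (by positivity) hl'
    have hQE : (ℙ : Measure Ω).real (evQ X (n k) (x k) (c k * x k)) ≤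
        (ℙ : Measure Ω).real {ω | (∑ i ∈ Finset.range (n k), X i ω) > x k} :=
      measureReal_mono fun ω h => h.1
    have h3' : (2 * A + D) * r k < 1 := by
      rw [lt_div_iff₀ (by positivity)] at h3
      linarith
    have fin := ratio_bound (n k) (x k ^ (-α)) (c k ^ α) (c k) (x k) A B D K √√(r k) (r k) _ _
      hn0 hp hq hq1 hck hck1.le hxk hAp hBp hDp hδ0 hrdef h3' hQE U Lo
    have hsq : r k / √√(r k) ^ 2 = √(r k) := by
      rw [Real.sq_sqrt (Real.sqrt_nonneg _), Real.div_sqrt]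
    rw [hsq, ← eqc] at fin
    exact fin
  exact tendsto_of_tendsto_of_tendsto_of_le_of_le' tendsto_const_nhds hupper
    (key.mono fun k h => h.1) (key.mono fun k h => h.2)
end

section
/- Let X_1, X_2, … be independent identically distributed real random variables whose common distribution is symmetric about 0 and absolutely continuous (has a probability density function). For n ∈ ℕ let S_n := X_1 + … + X_n. Then for every n ∈ ℕ and every real x > 0, P(S_n > x) ≥ (1/4)·(1 − exp(−2 n P(X_1 > x))). -/
open MeasureTheory ProbabilityTheory Filter

lemma feller_pi (n : ℕ) (μ : Measure ℝ) [IsProbabilityMeasure μ]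
    (hneg : MeasurePreserving (fun u : ℝ => -u) μ μ) (x : ℝ) (hx : 0 < x) :
    (1 / 4) * (1 - Real.exp (-2 * n * μ.real {u | x < u})) ≤
      (Measure.pi (fun _ : Fin n => μ)).real {y | x < ∑ i, y i} := by
  set ν := Measure.pi (fun _ : Fin n => μ) with hν
  set p := μ.real {u | x < u} with hp
  let D : Set (Fin n → ℝ) := {y | x < |∑ i, y i|}
  let P : Set (Fin n → ℝ) := {y | x < ∑ i, y i}
  let A : Fin n → Set (Fin n → ℝ) := fun j => {y | x < |y j| ∧ ∀ i < j, |y i| ≤ x}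
  let B : Set (Fin n → ℝ) := Set.univ.pi (fun _ => {u : ℝ | |u| ≤ x})
  have hDm : MeasurableSet D := measurableSet_lt (by fun_prop) (by fun_prop)
  have hPm : MeasurableSet P := measurableSet_lt (by fun_prop) (by fun_prop)
  have hCm : MeasurableSet {u : ℝ | |u| ≤ x} := measurableSet_le (by fun_prop) (by fun_prop)
  have hBm : MeasurableSet B := MeasurableSet.univ_pi (fun _ => hCm)
  have hAm : ∀ j, MeasurableSet (A j) := by
    intro j
    have h1 : MeasurableSet {y : Fin n → ℝ | x < |y j|} :=
      measurableSet_lt (by fun_prop) (by fun_prop)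
    have h2 : MeasurableSet {y : Fin n → ℝ | ∀ i < j, |y i| ≤ x} := by
      have : {y : Fin n → ℝ | ∀ i < j, |y i| ≤ x} = ⋂ i, ⋂ (_ : i < j), {y | |y i| ≤ x} := by
        ext y; simp
      rw [this]
      exact MeasurableSet.iInter fun i => MeasurableSet.iInter fun _ =>
        measurableSet_le (by fun_prop) (by fun_prop)
    exact h1.inter h2
  -- flips
  have hflip : ∀ (s : Fin n → Prop) [DecidablePred s], MeasurePreserving
      (fun (y : Fin n → ℝ) i => if s i then y i else - y i) ν ν := by
    intro s _
    have := measurePreserving_pi (fun _ : Fin n => μ) (fun _ : Fin n => μ)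
      (f := fun i u => if s i then u else -u) (by
        intro i
        by_cases h : s i
        · simp only [h, if_true]; exact MeasurePreserving.id μ
        · simpa [h] using hneg)
    exact this
  have hAD : ∀ j, ν.real (A j) ≤ 2 * ν.real (A j ∩ D) := by
    intro j
    have hT := hflip (fun i => i = j)
    set T : (Fin n → ℝ) → (Fin n → ℝ) := fun y i => if i = j then y i else - y i with hTdef
    have hTabs : ∀ y i, |T y i| = |y i| := by
      intro y i
      simp only [hTdef]; split_ifs <;> simp
    have hsum : ∀ y, ∑ i, y i + ∑ i, T y i = 2 * y j := by
      intro y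
      rw [← Finset.sum_add_distrib, Finset.sum_eq_single j]
      · simp [hTdef]; ring
      · intro i _ h; simp [hTdef, h]
      · simp
    have hsub : A j ⊆ (A j ∩ D) ∪ T ⁻¹' (A j ∩ D) := by
      intro y hy
      by_cases h : y ∈ D
      · exact Or.inl ⟨hy, h⟩
      · right
        refine ⟨?_, ?_⟩
        · simp only [A, Set.mem_ofPred_eq, hTabs] at hy ⊢; exact hy
        · by_contra h2
          simp only [D, Set.mem_ofPred_eq, not_lt] at h h2
          have h3 := abs_add_le (∑ i, y i) (∑ i, T y i)
          rw [hsum, abs_mul, abs_two] at h3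
          have := hy.1
          linarith
    calc ν.real (A j) ≤ ν.real ((A j ∩ D) ∪ T ⁻¹' (A j ∩ D)) := measureReal_mono hsub
      _ ≤ ν.real (A j ∩ D) + ν.real (T ⁻¹' (A j ∩ D)) := measureReal_union_le _ _
      _ = 2 * ν.real (A j ∩ D) := by
        rw [hT.measureReal_preimage ((hAm j).inter hDm).nullMeasurableSet]; ring
  have hBA : Bᶜ ⊆ ⋃ j, A j := by
    intro y hy
    have hex : ∃ j, x < |y j| := by
      by_contra h
      push Not at h
      exact hy (fun i _ => h i)
    let F : Finset (Fin n) := Finset.univ.filter (fun j => x < |y j|)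
    have hF : F.Nonempty := by
      obtain ⟨j, hj⟩ := hex
      exact ⟨j, by simp [F, hj]⟩
    refine Set.mem_iUnion.2 ⟨F.min' hF, ?_, ?_⟩
    · have := F.min'_mem hF
      simpa [F] using this
    · intro i hi
      by_contra h
      push Not at h
      exact absurd (F.min'_le i (by simp [F, h])) (not_le.2 hi)
  have hdisj : Pairwise (Function.onFun Disjoint (fun j => A j ∩ D)) := by
    intro i j hij
    refine Set.disjoint_left.2 ?_
    rintro y ⟨hi, -⟩ ⟨hj, -⟩
    rcases lt_or_gt_of_ne hij with h | h
    · exact absurd (hj.2 i h) (not_le.2 hi.1)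
    · exact absurd (hi.2 j h) (not_le.2 hj.1)
  have hB : ν.real Bᶜ ≤ 2 * ν.real D := by
    calc ν.real Bᶜ ≤ ν.real (⋃ j, A j) := measureReal_mono hBA
      _ ≤ ∑ j, ν.real (A j) := measureReal_iUnion_fintype_le _
      _ ≤ ∑ j, 2 * ν.real (A j ∩ D) := Finset.sum_le_sum fun j _ => hAD j
      _ = 2 * ν.real (⋃ j, A j ∩ D) := by
        rw [← Finset.mul_sum, measureReal_iUnion_fintype hdisj (fun j => (hAm j).inter hDm)]
      _ ≤ 2 * ν.real D := by
        gcongr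
        · simp
        · exact Set.iUnion_subset fun j => Set.inter_subset_right
  have hD : ν.real D ≤ 2 * ν.real P := by
    have hT := hflip (fun _ => False)
    have hsub : D ⊆ P ∪ (fun (y : Fin n → ℝ) i => if False then y i else - y i) ⁻¹' P := by
      intro y hy
      have hy' : x < |∑ i, y i| := hy
      rcases lt_abs.1 hy' with h | h
      · exact Or.inl h
      · right; simpa [P] using h
    calc ν.real D ≤ _ := measureReal_mono hsub
      _ ≤ _ := measureReal_union_le _ _
      _ = 2 * ν.real P := by
        rw [hT.measureReal_preimage hPm.nullMeasurableSet]; ring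
  have hBval : ν.real B = (μ.real {u : ℝ | |u| ≤ x}) ^ n := by
    simp [hν, B, Measure.real, Measure.pi_pi]
  have hone : μ.real {u : ℝ | |u| ≤ x} = 1 - 2 * p := by
    have h1 : {u : ℝ | |u| ≤ x}ᶜ = {u | x < u} ∪ (fun u : ℝ => -u) ⁻¹' {u | x < u} := by
      ext u; simp [lt_abs]
    have hm : MeasurableSet {u : ℝ | x < u} := measurableSet_Ioi
    have h2 : μ.real {u : ℝ | |u| ≤ x}ᶜ = 2 * p := by
      rw [h1, measureReal_union _ (hneg.measurable hm),
        hneg.measureReal_preimage hm.nullMeasurableSet]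
      · ring
      · refine Set.disjoint_left.2 ?_
        intro u hu hu'
        simp only [Set.mem_ofPred_eq, Set.mem_preimage] at hu hu'
        linarith
    have := probReal_add_probReal_compl (μ := μ) hCm
    linarith
  have hexp : ν.real B ≤ Real.exp (-2 * n * p) := by
    rw [hBval]
    calc (μ.real {u : ℝ | |u| ≤ x}) ^ n ≤ (Real.exp (-2 * p)) ^ n := by
          gcongr
          rw [hone]
          have := Real.add_one_le_exp (-2 * p)
          linarith
      _ = Real.exp (-2 * n * p) := by rw [← Real.exp_nat_mul]; ring_nf
  have := probReal_add_probReal_compl (μ := ν) hBm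
  change _ ≤ ν.real P
  linarith

theorem feller_lower_bound
    {Ω : Type*} [MeasureSpace Ω] [IsProbabilityMeasure (ℙ : Measure Ω)]
    (X : ℕ → Ω → ℝ) (hmeas : ∀ i, Measurable (X i))
    (hindep : iIndepFun X ℙ)
    (hident : ∀ i, IdentDistrib (X i) (X 0) ℙ ℙ)
    (hsymm : Measure.map (X 0) ℙ = Measure.map (fun ω => -(X 0 ω)) ℙ)
    (f : ℝ → ℝ) (hf0 : ∀ u, 0 ≤ f u) (hfmeas : Measurable f)
    (hpdf : Measure.map (X 0) ℙ = (volume : Measure ℝ).withDensity (fun u => ENNReal.ofReal (f u)))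
    (n : ℕ) (hn : 0 < n) (x : ℝ) (hx : 0 < x) :
    (ℙ {ω | (∑ i ∈ Finset.range n, X i ω) > x}).toReal ≥
      (1 / 4) * (1 - Real.exp (-2 * n * (ℙ {ω | X 0 ω > x}).toReal)) := by
  have : IsProbabilityMeasure (Measure.map (X 0) (ℙ : Measure Ω)) :=
    Measure.isProbabilityMeasure_map (hmeas 0).aemeasurable
  have hneg : MeasurePreserving (fun u : ℝ => -u)
      (Measure.map (X 0) (ℙ : Measure Ω)) (Measure.map (X 0) ℙ) := by
    refine ⟨measurable_neg, ?_⟩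
    rw [Measure.map_map measurable_neg (hmeas 0)]
    exact hsymm.symm
  have key := feller_pi n (Measure.map (X 0) ℙ) hneg x hx
  have hind : iIndepFun (fun i : Fin n => X i) (ℙ : Measure Ω) :=
    hindep.precomp Fin.val_injective
  have hmap := (iIndepFun_iff_map_fun_eq_pi_map
    (fun i : Fin n => (hmeas i).aemeasurable)).1 hind
  have hmap' : Measure.pi (fun _ : Fin n => Measure.map (X 0) (ℙ : Measure Ω)) =
      Measure.map (fun ω (i : Fin n) => X i ω) ℙ := by
    rw [hmap]
    congr 1
    funext i
    exact (hident i).map_eq.symm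
  rw [hmap', map_measureReal_apply (measurable_pi_lambda _ fun i => hmeas _)
    (measurableSet_lt (by fun_prop) (by fun_prop)),
    map_measureReal_apply (hmeas 0)
      (measurableSet_lt (by fun_prop) (by fun_prop))] at key
  simp only [Set.preimage_ofPred_eq, Measure.real] at key
  have hs : ∀ ω, ∑ i ∈ Finset.range n, X i ω = ∑ i : Fin n, X i ω := fun ω =>
    (Fin.sum_univ_eq_sum_range (fun i => X i ω) n).symm
  simp only [hs]
  exact key
end

section
/- Let α ∈ (0,2). Let X_1, X_2, … be independent identically distributed real random variables whose common distribution is symmetric about 0 and has a probability density function f satisfying f(u) ≍ u^{-1-α} as u → ∞. For n ∈ ℕ, x > 0, and c ∈ (0,1), set Y_i := X_i·1(|X_i| ≤ c x) and T_n := Y_1 + … + Y_n. Then for any sequences (n_k) of positive integers, (x_k) of positive reals, and (c_k) in (0,1) with n_k / x_k^α → 0 and (n_k x_k^{-α}) / c_k^{2α} → 0, there is a constant C > 0 such that P(T_{n_k} > x_k) ≤ C · c_k^{2-α} · n_k x_k^{-α} for all sufficiently large k. -/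
open MeasureTheory ProbabilityTheory Filter

/-- The truncated second moment grows at most like `M ^ (2 - α)`. -/
lemma trunc_second_moment (μ : Measure ℝ) [IsProbabilityMeasure μ]
    (α : ℝ) (hα : α ∈ Set.Ioo (0 : ℝ) 2)
    (hsymm : μ = μ.map (fun u => -u))
    (f : ℝ → ℝ) (hf0 : ∀ u, 0 ≤ f u) (hfmeas : Measurable f)
    (hpdf : μ = (volume : Measure ℝ).withDensity (fun u => ENNReal.ofReal (f u)))
    (K0 u0 : ℝ) (hK0 : 0 < K0) (hu0 : 0 < u0)
    (htail : ∀ u, u0 ≤ u → f u ≤ K0 * u ^ (-1 - α)) (M : ℝ) (hM : 1 ≤ M) :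
    ∫ u, (if |u| ≤ M then u else 0) ^ 2 ∂μ ≤ (u0 ^ 2 + 2 * K0 / (2 - α)) * M ^ (2 - α) := by
  obtain ⟨h0, h2⟩ := hα
  set h : ℝ → ℝ := (Set.Ioc u0 M).indicator (fun u => u ^ 2) with hh
  have hhm : Measurable h := (measurable_id.pow_const 2).indicator measurableSet_Ioc
  have hhb : ∀ u, 0 ≤ h u ∧ h u ≤ M ^ 2 := by
    intro u
    by_cases hu : u ∈ Set.Ioc u0 M
    · simp only [hh, Set.indicator_of_mem hu]
      exact ⟨sq_nonneg u, by nlinarith [hu.1, hu.2]⟩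
    · simp only [hh, Set.indicator_of_notMem hu]
      exact ⟨le_rfl, sq_nonneg M⟩
  have hint : Integrable h μ :=
    Integrable.of_bound hhm.aestronglyMeasurable (M ^ 2)
      (ae_of_all _ fun u => by rw [Real.norm_eq_abs, abs_of_nonneg (hhb u).1]; exact (hhb u).2)
  have hint' : Integrable (fun u => h (-u)) μ :=
    Integrable.of_bound (hhm.comp measurable_neg).aestronglyMeasurable (M ^ 2)
      (ae_of_all _ fun u => by rw [Real.norm_eq_abs, abs_of_nonneg (hhb _).1]; exact (hhb _).2)
  have hneg : ∫ u, h (-u) ∂μ = ∫ u, h u ∂μ := by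
    conv_rhs => rw [hsymm]
    rw [integral_map measurable_neg.aemeasurable hhm.aestronglyMeasurable]
  have hmain : ∫ u, h u ∂μ ≤ K0 * (M ^ (2 - α) / (2 - α)) := by
    have hI : ∫ u in Set.Ioc 0 M, K0 * u ^ (1 - α) = K0 * (M ^ (2 - α) / (2 - α)) := by
      rw [← intervalIntegral.integral_of_le (by linarith), intervalIntegral.integral_const_mul,
        integral_rpow (Or.inl (by linarith)), show 1 - α + 1 = 2 - α by ring,
        Real.zero_rpow (by linarith), sub_zero]
    rw [← hI, hpdf, integral_withDensity_eq_integral_toReal_smul (by fun_prop)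
      (ae_of_all _ fun u => ENNReal.ofReal_lt_top), ← integral_indicator measurableSet_Ioc]
    apply integral_mono_of_nonneg
    · exact ae_of_all _ fun u => mul_nonneg ENNReal.toReal_nonneg (hhb u).1
    · rw [integrable_indicator_iff measurableSet_Ioc]
      have := (intervalIntegral.intervalIntegrable_rpow' (a := 0) (b := M)
        (r := 1 - α) (by linarith)).const_mul K0
      rwa [intervalIntegrable_iff_integrableOn_Ioc_of_le (by linarith)] at this
    · refine ae_of_all _ fun u => ?_
      simp only [smul_eq_mul, ENNReal.toReal_ofReal (hf0 u)]
      by_cases hu : u ∈ Set.Ioc u0 M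
      · have hup : 0 < u := hu0.trans hu.1
        have hu' : u ∈ Set.Ioc 0 M := ⟨hup, hu.2⟩
        simp only [hh, Set.indicator_of_mem hu, Set.indicator_of_mem hu']
        have := mul_le_mul_of_nonneg_right (htail u hu.1.le) (sq_nonneg u)
        refine this.trans (le_of_eq ?_)
        rw [mul_assoc, ← Real.rpow_natCast, ← Real.rpow_add hup]
        congr 2; push_cast; ring
      · simp only [hh, Set.indicator_of_notMem hu, mul_zero]
        exact Set.indicator_nonneg (fun v hv =>
          mul_nonneg hK0.le (Real.rpow_nonneg hv.1.le _)) u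
  have hle : ∫ u, (if |u| ≤ M then u else 0) ^ 2 ∂μ ≤ ∫ u, (u0 ^ 2 + (h u + h (-u))) ∂μ := by
    apply integral_mono_of_nonneg
    · exact ae_of_all _ fun u => sq_nonneg _
    · exact (integrable_const _).add (hint.add hint')
    · refine ae_of_all _ fun u => ?_
      have ha := (hhb u).1
      have hb := (hhb (-u)).1
      simp only
      split_ifs with hu
      · rw [abs_le] at hu
        by_cases h1 : u0 < u
        · have : h u = u ^ 2 := Set.indicator_of_mem (show u ∈ Set.Ioc u0 M from ⟨h1, hu.2⟩) _
          nlinarith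
        · by_cases h3 : u0 < -u
          · have : h (-u) = (-u) ^ 2 :=
              Set.indicator_of_mem (show -u ∈ Set.Ioc u0 M from ⟨h3, by linarith⟩) _
            nlinarith
          · nlinarith
      · nlinarith
  have hsum : Integrable (fun u => h u + h (-u)) μ := hint.add hint'
  rw [integral_add (integrable_const _) hsum, integral_add hint hint', hneg] at hle
  simp only [integral_const, probReal_univ, one_smul] at hle
  have hM1 : 1 ≤ M ^ (2 - α) := Real.one_le_rpow hM (by linarith)
  have hfin : (u0 ^ 2 + 2 * K0 / (2 - α)) * M ^ (2 - α)
      = u0 ^ 2 * M ^ (2 - α) + 2 * (K0 * (M ^ (2 - α) / (2 - α))) := by ring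
  rw [hfin]
  nlinarith [sq_nonneg u0]

theorem truncated_sum_tail_bound
    {Ω : Type*} [MeasureSpace Ω] [IsProbabilityMeasure (ℙ : Measure Ω)]
    (α : ℝ) (hα : α ∈ Set.Ioo (0 : ℝ) 2)
    (X : ℕ → Ω → ℝ) (hmeas : ∀ i, Measurable (X i))
    (hindep : iIndepFun X ℙ)
    (hident : ∀ i, IdentDistrib (X i) (X 0) ℙ ℙ)
    (hsymm : Measure.map (X 0) ℙ = Measure.map (fun ω => -(X 0 ω)) ℙ)
    (f : ℝ → ℝ) (hf0 : ∀ u, 0 ≤ f u) (hfmeas : Measurable f)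
    (hpdf : Measure.map (X 0) ℙ = (volume : Measure ℝ).withDensity (fun u => ENNReal.ofReal (f u)))
    (k0 K0 u0 : ℝ) (hk0 : 0 < k0) (hK0 : k0 ≤ K0) (hu0 : 0 < u0)
    (htail : ∀ u, u0 ≤ u → k0 * u ^ (-1 - α) ≤ f u ∧ f u ≤ K0 * u ^ (-1 - α))
    (n : ℕ → ℕ) (hn : ∀ k, 0 < n k)
    (x : ℕ → ℝ) (hx : ∀ k, 0 < x k)
    (c : ℕ → ℝ) (hc : ∀ k, c k ∈ Set.Ioo (0 : ℝ) 1)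
    (hLD : Tendsto (fun k => (n k : ℝ) / x k ^ α) atTop (nhds 0))
    (hcc : Tendsto (fun k => (n k : ℝ) * x k ^ (-α) / c k ^ (2 * α)) atTop (nhds 0))
:
    ∃ C : ℝ, 0 < C ∧ ∀ᶠ k in atTop,
      (ℙ {ω | (∑ i ∈ Finset.range (n k), (if |X i ω| ≤ c k * x k then X i ω else 0)) > x k}).toReal ≤
        C * c k ^ (2 - α) * ((n k : ℝ) * x k ^ (-α)) := by
  have hα' := hα
  obtain ⟨h0, h2⟩ := hα'
  have hK : 0 < K0 := hk0.trans_le hK0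
  set μ := Measure.map (X 0) (ℙ : Measure Ω) with hμ
  have : IsProbabilityMeasure μ := Measure.isProbabilityMeasure_map (hmeas 0).aemeasurable
  have hs : μ = μ.map (fun u => -u) := by
    conv_rhs => rw [hμ, Measure.map_map measurable_neg (hmeas 0)]
    exact hsymm
  have hD : 0 < u0 ^ 2 + 2 * K0 / (2 - α) := by
    have : 0 < 2 - α := by linarith
    positivity
  refine ⟨u0 ^ 2 + 2 * K0 / (2 - α), hD, ?_⟩
  have hev : ∀ᶠ k in atTop, (n k : ℝ) * x k ^ (-α) / c k ^ (2 * α) < 1 :=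
    hcc.eventually_lt_const one_pos
  filter_upwards [hev] with k hk
  have hxk := hx k
  obtain ⟨hc0, hc1⟩ := hc k
  set M := c k * x k with hMdef
  have hMpos : 0 < M := mul_pos hc0 hxk
  have hM : 1 ≤ M := by
    by_contra hlt
    push Not at hlt
    have hn1 : (1 : ℝ) ≤ n k := by exact_mod_cast hn k
    rw [div_lt_one (Real.rpow_pos_of_pos hc0 _)] at hk
    have hxp : 0 < x k ^ (-α) := Real.rpow_pos_of_pos hxk _
    have h3 : x k ^ (-α) < c k ^ (2 * α) := by nlinarith
    have h4 : c k ^ (2 * α) ≤ c k ^ α :=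
      Real.rpow_le_rpow_of_exponent_ge hc0 hc1.le (by linarith)
    have h5 : M ^ α < 1 := Real.rpow_lt_one hMpos.le hlt h0
    rw [hMdef, Real.mul_rpow hc0.le hxk.le] at h5
    have h6 : x k ^ (-α) * x k ^ α = 1 := by
      rw [← Real.rpow_add hxk]; simp
    have h7 : 0 < x k ^ α := Real.rpow_pos_of_pos hxk _
    nlinarith
  set g : ℝ → ℝ := fun u => if |u| ≤ M then u else 0 with hg
  have hgm : Measurable g :=
    Measurable.ite (measurableSet_le measurable_id.abs measurable_const)
      measurable_id measurable_const
  have hgb : ∀ u, ‖g u‖ ≤ M := by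
    intro u
    simp only [hg]
    split_ifs with hu
    · exact hu
    · simpa using hMpos.le
  have hgL : ∀ i, MemLp (fun ω => g (X i ω)) 2 (ℙ : Measure Ω) := fun i =>
    MemLp.of_bound (hgm.comp (hmeas i)).aestronglyMeasurable M (ae_of_all _ fun ω => hgb _)
  have hmap : ∀ i, Measure.map (X i) ℙ = μ := fun i => (hident i).map_eq
  have hmean : ∀ i, ∫ ω, g (X i ω) = 0 := by
    intro i
    rw [← integral_map (hmeas i).aemeasurable hgm.aestronglyMeasurable, hmap]
    have h1 : ∫ u, g u ∂μ = ∫ u, g (-u) ∂μ := by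
      conv_lhs => rw [hs]
      rw [integral_map measurable_neg.aemeasurable hgm.aestronglyMeasurable]
    have h3 : ∀ u, g (-u) = - g u := by
      intro u
      simp only [hg, abs_neg]
      split_ifs <;> simp
    simp only [h3, integral_neg] at h1
    linarith
  have hvar : ∀ i, Var[fun ω => g (X i ω); ℙ] ≤ (u0 ^ 2 + 2 * K0 / (2 - α)) * M ^ (2 - α) := by
    intro i
    rw [variance_eq_integral (X := fun ω => g (X i ω)) (hgm.comp (hmeas i)).aemeasurable, hmean]
    simp only [sub_zero]
    rw [← integral_map (f := fun u => g u ^ 2) (hmeas i).aemeasurable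
      (hgm.pow_const 2).aestronglyMeasurable, hmap]
    exact trunc_second_moment μ α hα hs f hf0 hfmeas hpdf K0 u0 hK hu0
      (fun u hu => (htail u hu).2) M hM
  set T : Ω → ℝ := ∑ i ∈ Finset.range (n k), fun ω => g (X i ω) with hT
  have hTL : MemLp T 2 (ℙ : Measure Ω) := memLp_finsetSum' _ fun i _ => hgL i
  have hTapp : ∀ ω, T ω = ∑ i ∈ Finset.range (n k), g (X i ω) := fun ω => by
    simp [hT]
  have hTmean : ∫ ω, T ω = 0 := by
    simp only [hTapp]
    rw [integral_finsetSum _ fun i _ => (hgL i).integrable (by norm_num)]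
    simp [hmean]
  have hTvar : Var[T; ℙ] ≤ n k * ((u0 ^ 2 + 2 * K0 / (2 - α)) * M ^ (2 - α)) := by
    rw [hT, IndepFun.variance_sum (fun i _ => hgL i)]
    · refine (Finset.sum_le_sum fun i _ => hvar i).trans ?_
      simp
    · intro i _ j _ hij
      exact (hindep.indepFun hij).comp hgm hgm
  have hcheb := meas_ge_le_variance_div_sq hTL hxk
  rw [hTmean] at hcheb
  have hsub : (ℙ {ω | (∑ i ∈ Finset.range (n k), g (X i ω)) > x k}) ≤
      ENNReal.ofReal (Var[T; ℙ] / x k ^ 2) := by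
    refine (measure_mono fun ω hω => ?_).trans hcheb
    simp only [Set.mem_ofPred_eq, sub_zero] at hω ⊢
    rw [hTapp]
    exact hω.le.trans (le_abs_self _)
  have hreal := ENNReal.toReal_mono ENNReal.ofReal_ne_top hsub
  rw [ENNReal.toReal_ofReal (div_nonneg (variance_nonneg _ _) (sq_nonneg _))] at hreal
  refine hreal.trans ?_
  rw [div_le_iff₀ (by positivity)]
  refine hTvar.trans (le_of_eq ?_)
  rw [hMdef, Real.mul_rpow hc0.le hxk.le]
  have hxx : x k ^ (2 - α) = x k ^ (-α) * x k ^ 2 := by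
    rw [← Real.rpow_natCast (x k) 2, ← Real.rpow_add hxk]
    congr 1; push_cast; ring
  rw [hxx]; ring
end

section
/- Let α ∈ (0,2). Let X_1, X_2, … be independent identically distributed real random variables whose common distribution is symmetric about 0 and has a probability density function f satisfying f(u) ≍ u^{-1-α} as u → ∞. For n ∈ ℕ let S_n := X_1 + … + X_n. Then for any sequences (n_k) of positive integers, (x_k) of positive reals, and (c_k), (b_k) in (0,1) with n_k / x_k^α → 0, (n_k x_k^{-α}) / c_k^{2α} → 0, and (n_k x_k^{-α}) / (b_k^2 c_k^{α-2}) → 0, one has n_k · P( X_1 > x_k, |S_{n_k} − X_1| > b_k x_k, and max_{j ∈ {2,…,n_k}} |X_j| ≤ c_k x_k ) / P(S_{n_k} > x_k) → 0 as k → ∞. -/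
open MeasureTheory ProbabilityTheory Filter

namespace RemTerm

lemma indep_mul {Ω : Type*} [MeasurableSpace Ω] {μ : Measure Ω} [IsProbabilityMeasure μ]
    {X : ℕ → Ω → ℝ} (hmeas : ∀ i, Measurable (X i)) (hindep : iIndepFun X μ)
    (j : ℕ) (T : Finset ℕ) (hj : j ∉ T) (A : Set ℝ) (hA : MeasurableSet A)
    (B : Set (T → ℝ)) (hB : MeasurableSet B) :
    μ.real {ω | X j ω ∈ A ∧ (fun i : T => X i ω) ∈ B}
      = μ.real {ω | X j ω ∈ A} * μ.real {ω | (fun i : T => X i ω) ∈ B} := by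
  have h := hindep.indepFun_finset {j} T (by simpa using hj) hmeas
  have h2 : IndepFun (X j) (fun ω (i : T) => X i ω) μ := by
    have hφ : Measurable (fun v : (({j} : Finset ℕ) → ℝ) => v ⟨j, by simp⟩) :=
      measurable_pi_apply _
    exact h.comp hφ measurable_id
  have := h2.measure_inter_preimage_eq_mul A B hA hB
  simp only [Measure.real]
  rw [← ENNReal.toReal_mul]
  congr 1

lemma half_le {Ω : Type*} [MeasurableSpace Ω] {μ : Measure Ω} [IsProbabilityMeasure μ]
    {X : ℕ → Ω → ℝ} (hmeas : ∀ i, Measurable (X i)) (hindep : iIndepFun X μ)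
    (hs : ∀ i, IdentDistrib (X i) (fun ω => - X i ω) μ μ) (T : Finset ℕ) :
    1 / 2 ≤ μ.real {ω | 0 ≤ ∑ i ∈ T, X i ω} := by
  have h1 : iIndepFun (fun i ω => - X i ω) μ :=
    hindep.comp (fun _ x => -x) (fun _ => measurable_neg)
  have h2 := IdentDistrib.pi hs hindep h1
  have h3 := h2.comp (u := fun v : ℕ → ℝ => ∑ i ∈ T, v i) (by fun_prop)
  have h4 := h3.measure_mem_eq (s := Set.Ici 0) measurableSet_Ici
  have h5 : μ.real {ω | 0 ≤ ∑ i ∈ T, X i ω} = μ.real {ω | ∑ i ∈ T, X i ω ≤ 0} := by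
    simp only [Measure.real]
    congr 1
    refine Eq.trans h4 ?_
    congr 1
    ext ω
    change 0 ≤ ∑ i ∈ T, - X i ω ↔ ∑ i ∈ T, X i ω ≤ 0
    simp
  have h6 : μ.real (Set.univ) ≤ μ.real {ω | 0 ≤ ∑ i ∈ T, X i ω} + μ.real {ω | ∑ i ∈ T, X i ω ≤ 0} := by
    refine le_trans (measureReal_mono ?_) (measureReal_union_le _ _)
    intro ω _
    exact le_total (0 : ℝ) (∑ i ∈ T, X i ω)
  simp at h6
  linarith

lemma lower {Ω : Type*} [MeasurableSpace Ω] {μ : Measure Ω} [IsProbabilityMeasure μ]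
    {X : ℕ → Ω → ℝ} (hmeas : ∀ i, Measurable (X i)) (hindep : iIndepFun X μ)
    (hs : ∀ i, IdentDistrib (X i) (fun ω => - X i ω) μ μ) (n : ℕ) (x p : ℝ)
    (hp : ∀ i, μ.real {ω | X i ω > x} = p) :
    n * (p * (1 / 2 - n * p)) ≤ μ.real {ω | ∑ i ∈ Finset.range n, X i ω > x} := by
  classical
  have hp0 : 0 ≤ p := by rw [← hp 0]; positivity
  let T : ℕ → Finset ℕ := fun j => (Finset.range n).erase j
  let B : (j : ℕ) → Set (T j → ℝ) := fun j => {v | 0 ≤ ∑ i, v i} ∩ {v | ∀ i, v i ≤ x}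
  have hB : ∀ j, MeasurableSet (B j) := by
    intro j
    apply MeasurableSet.inter
    · exact measurableSet_le measurable_const (by fun_prop)
    · rw [Set.ofPred_forall]
      exact MeasurableSet.iInter fun i => measurableSet_le (by fun_prop) measurable_const
  let A : ℕ → Set Ω := fun j => {ω | X j ω ∈ Set.Ioi x ∧ (fun i : T j => X i ω) ∈ B j}
  have hAm : ∀ j, MeasurableSet (A j) := by
    intro j
    apply MeasurableSet.inter
    · exact hmeas j measurableSet_Ioi
    · exact (measurable_pi_lambda _ (fun i : T j => hmeas i)) (hB j)
  have hsumT : ∀ j ω, ∑ i : T j, X i ω = ∑ i ∈ T j, X i ω := by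
    intro j ω
    exact Finset.sum_coe_sort (T j) (fun i => X i ω)
  have hA : ∀ j ∈ Finset.range n, p * (1 / 2 - n * p) ≤ μ.real (A j) := by
    intro j hj
    have h1 : μ.real (A j) = _ := indep_mul hmeas hindep j (T j) (by simp [T]) _ measurableSet_Ioi _ (hB j)
    rw [h1]
    have h2 : μ.real {ω | X j ω ∈ Set.Ioi x} = p := hp j
    rw [h2]
    refine mul_le_mul_of_nonneg_left ?_ hp0
    have h3 := half_le hmeas hindep hs (T j)
    have h4 : {ω | 0 ≤ ∑ i ∈ T j, X i ω} ⊆ {ω | (fun i : T j => X i ω) ∈ B j} ∪ ⋃ i ∈ T j, {ω | X i ω > x} := by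
      intro ω hω
      by_cases h : ∃ i ∈ T j, X i ω > x
      · right; simpa using h
      · left
        push Not at h
        refine ⟨?_, ?_⟩
        · change 0 ≤ ∑ i : T j, X i ω
          rw [hsumT]; exact hω
        · intro i; exact h i i.2
    have h5 := (measureReal_mono (μ := μ) h4).trans (measureReal_union_le _ _)
    have h6 : μ.real (⋃ i ∈ T j, {ω | X i ω > x}) ≤ n * p := by
      refine (measureReal_biUnion_finset_le _ _).trans ?_
      simp only [hp, Finset.sum_const, nsmul_eq_mul]
      refine mul_le_mul_of_nonneg_right ?_ hp0
      have : (T j).card ≤ n := (Finset.card_erase_le).trans (by simp)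
      exact_mod_cast this
    linarith
  have hdisj : Set.PairwiseDisjoint (↑(Finset.range n)) A := by
    intro i hi j hj hij
    rw [Function.onFun, Set.disjoint_left]
    intro ω h1 h2
    have := h1.2.2 ⟨j, by simp only [T, Finset.mem_erase]; exact ⟨hij.symm, hj⟩⟩
    have h3 : x < X j ω := h2.1
    simp at this
    linarith
  calc (n : ℝ) * (p * (1 / 2 - n * p)) = ∑ j ∈ Finset.range n, (p * (1 / 2 - n * p)) := by simp
    _ ≤ ∑ j ∈ Finset.range n, μ.real (A j) := Finset.sum_le_sum hA
    _ = μ.real (⋃ j ∈ Finset.range n, A j) := (measureReal_biUnion_finset hdisj (fun j _ => hAm j)).symm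
    _ ≤ _ := by
      refine measureReal_mono ?_
      intro ω hω
      simp only [Set.mem_iUnion] at hω
      obtain ⟨j, hj, h1, h2⟩ := hω
      have h3 : 0 ≤ ∑ i : T j, X i ω := h2.1
      rw [hsumT] at h3
      have h4 : x < X j ω := h1
      have := Finset.add_sum_erase (Finset.range n) (fun i => X i ω) hj
      simp only [Set.mem_ofPred_eq]
      simp only [T] at h3
      linarith

noncomputable def tr (M : ℝ) (u : ℝ) : ℝ := Set.indicator (Set.Icc (-M) M) id u

lemma tr_meas (M : ℝ) : Measurable (tr M) := measurable_id.indicator measurableSet_Icc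

lemma tr_bd {M : ℝ} (hM : 0 ≤ M) (u : ℝ) : |tr M u| ≤ M := by
  unfold tr
  by_cases h : u ∈ Set.Icc (-M) M
  · simpa [Set.indicator_of_mem h] using abs_le.2 h
  · simpa [Set.indicator_of_notMem h] using hM

lemma tr_neg (M : ℝ) (u : ℝ) : tr M (-u) = - tr M u := by
  unfold tr
  by_cases h : u ∈ Set.Icc (-M) M
  · have h' : -u ∈ Set.Icc (-M) M := ⟨by linarith [h.2], by linarith [h.1]⟩
    rw [Set.indicator_of_mem h, Set.indicator_of_mem h']; rfl
  · have h' : -u ∉ Set.Icc (-M) M := fun h' => h ⟨by linarith [h'.2], by linarith [h'.1]⟩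
    rw [Set.indicator_of_notMem h, Set.indicator_of_notMem h']; simp

lemma cheb {Ω : Type*} [MeasurableSpace Ω] {μ : Measure Ω} [IsProbabilityMeasure μ]
    {X : ℕ → Ω → ℝ} (hmeas : ∀ i, Measurable (X i)) (hindep : iIndepFun X μ)
    (hident : ∀ i, IdentDistrib (X i) (X 0) μ μ)
    (hs : ∀ i, IdentDistrib (X i) (fun ω => - X i ω) μ μ) (T : Finset ℕ) (M y : ℝ)
    (hM : 0 ≤ M) (hy : 0 < y) :
    μ.real {ω | |∑ i ∈ T, X i ω| > y ∧ ∀ i ∈ T, |X i ω| ≤ M}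
      ≤ T.card * (∫ ω, (tr M (X 0 ω)) ^ 2 ∂μ) / y ^ 2 := by
  let Y : ℕ → Ω → ℝ := fun i ω => tr M (X i ω)
  have hYm : ∀ i, Measurable (Y i) := fun i => (tr_meas M).comp (hmeas i)
  have hYL : ∀ i, MemLp (Y i) 2 μ := fun i =>
    MemLp.of_bound (hYm i).aestronglyMeasurable M (Eventually.of_forall fun ω => tr_bd hM _)
  have hYind : iIndepFun Y μ := hindep.comp (fun _ => tr M) (fun _ => tr_meas M)
  have hY0 : ∀ i, ∫ ω, Y i ω ∂μ = 0 := by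
    intro i
    have h := ((hs i).comp (tr_meas M)).integral_eq
    simp only [Function.comp_def, tr_neg, integral_neg] at h
    change ∫ ω, tr M (X i ω) ∂μ = 0
    linarith
  have hvar : ∀ i, variance (Y i) μ ≤ ∫ ω, (tr M (X 0 ω)) ^ 2 ∂μ := by
    intro i
    have h : variance (Y i) μ = variance (Y 0) μ := ((hident i).comp (tr_meas M)).variance_eq
    rw [h]
    exact variance_le_expectation_sq (hYm 0).aestronglyMeasurable
  have hsum : variance (∑ i ∈ T, Y i) μ ≤ T.card * (∫ ω, (tr M (X 0 ω)) ^ 2 ∂μ) := by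
    rw [IndepFun.variance_sum (fun i _ => hYL i) (fun i _ j _ hij => hYind.indepFun hij)]
    refine (Finset.sum_le_sum (fun i _ => hvar i)).trans ?_
    simp
  have hL : MemLp (∑ i ∈ T, Y i) 2 μ := memLp_finsetSum' _ (fun i _ => hYL i)
  have hmean : ∫ ω, (∑ i ∈ T, Y i) ω ∂μ = 0 := by
    simp only [Finset.sum_apply]
    rw [integral_finsetSum _ (fun i _ => (hYL i).integrable (by norm_num))]
    simp [hY0]
  have hch := meas_ge_le_variance_div_sq hL hy
  rw [hmean] at hch
  have h1 : μ.real {ω | |∑ i ∈ T, X i ω| > y ∧ ∀ i ∈ T, |X i ω| ≤ M} ≤ variance (∑ i ∈ T, Y i) μ / y ^ 2 := by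
    refine ENNReal.toReal_le_of_le_ofReal (div_nonneg (variance_nonneg _ _) (by positivity)) ?_
    refine (measure_mono ?_).trans hch
    intro ω hω
    have : ∑ i ∈ T, Y i ω = ∑ i ∈ T, X i ω := by
      refine Finset.sum_congr rfl fun i hi => ?_
      have := hω.2 i hi
      exact Set.indicator_of_mem (s := Set.Icc (-M) M) (abs_le.1 this) (id : ℝ → ℝ)
    simp only [Set.mem_ofPred_eq, Finset.sum_apply, this, sub_zero]
    exact hω.1.le
  exact h1.trans (by gcongr)

lemma tail_le {Ω : Type*} [MeasurableSpace Ω] {μ : Measure Ω} [IsProbabilityMeasure μ]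
    {X : Ω → ℝ} (hmeas : Measurable X) {f : ℝ → ℝ}
    (hpdf : Measure.map X μ = (volume : Measure ℝ).withDensity (fun u => ENNReal.ofReal (f u)))
    {α K0 u0 : ℝ} (hα : 0 < α) (hK0 : 0 < K0) (hu0 : 0 < u0)
    (htail : ∀ u, u0 ≤ u → f u ≤ K0 * u ^ (-1 - α)) (x : ℝ) (hx : u0 ≤ x) :
    μ.real {ω | X ω > x} ≤ K0 / α * x ^ (-α) := by
  have hx0 : 0 < x := hu0.trans_le hx
  have h1 : μ {ω | X ω > x} = ∫⁻ u in Set.Ioi x, ENNReal.ofReal (f u) := by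
    rw [← withDensity_apply _ measurableSet_Ioi, ← hpdf, Measure.map_apply hmeas measurableSet_Ioi]
    rfl
  have hint : IntegrableOn (fun u : ℝ => K0 * u ^ (-1 - α)) (Set.Ioi x) :=
    (integrableOn_Ioi_rpow_of_lt (by linarith) hx0).const_mul K0
  refine ENNReal.toReal_le_of_le_ofReal (by positivity) ?_
  rw [h1]
  have h2 : ∫⁻ u in Set.Ioi x, ENNReal.ofReal (f u)
      ≤ ∫⁻ u in Set.Ioi x, ENNReal.ofReal (K0 * u ^ (-1 - α)) := by
    refine setLIntegral_mono' measurableSet_Ioi fun u hu => ENNReal.ofReal_le_ofReal ?_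
    exact htail u (hx.trans (le_of_lt hu))
  refine h2.trans ?_
  rw [← ofReal_integral_eq_lintegral_ofReal hint]
  · rw [integral_const_mul, integral_Ioi_rpow_of_lt (by linarith) hx0]
    apply le_of_eq
    congr 1
    rw [show -1 - α + 1 = -α by ring]
    field_simp
  · refine (ae_restrict_mem measurableSet_Ioi).mono fun u hu => ?_
    have : 0 < u := hx0.trans hu
    positivity

lemma second_le {Ω : Type*} [MeasurableSpace Ω] {μ : Measure Ω} [IsProbabilityMeasure μ]
    {X : Ω → ℝ} (hmeas : Measurable X) {f : ℝ → ℝ} (hf0 : ∀ u, 0 ≤ f u) (hfmeas : Measurable f)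
    (hs : IdentDistrib X (fun ω => - X ω) μ μ)
    (hpdf : Measure.map X μ = (volume : Measure ℝ).withDensity (fun u => ENNReal.ofReal (f u)))
    {α K0 u0 : ℝ} (hα : α < 2) (hK0 : 0 < K0) (hu0 : 0 < u0)
    (htail : ∀ u, u0 ≤ u → f u ≤ K0 * u ^ (-1 - α)) (M : ℝ) (hM : u0 ≤ M) :
    ∫ ω, (tr M (X ω)) ^ 2 ∂μ ≤ (u0 ^ α + 2 * (K0 / (2 - α))) * M ^ (2 - α) := by
  have hM0 : 0 < M := hu0.trans_le hM
  let h : ℝ → ℝ := Set.indicator (Set.Ioc u0 M) (fun u => u ^ 2)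
  have hhm : Measurable h := (by fun_prop : Measurable fun u : ℝ => u ^ 2).indicator measurableSet_Ioc
  have hh0 : ∀ u, 0 ≤ h u := fun u => Set.indicator_nonneg (fun u _ => sq_nonneg u) u
  have hhb : ∀ u, h u ≤ M ^ 2 := by
    intro u
    by_cases hu : u ∈ Set.Ioc u0 M
    · simp only [h, Set.indicator_of_mem hu]
      have : 0 < u := hu0.trans hu.1
      exact pow_le_pow_left₀ this.le hu.2 2
    · simp only [h, Set.indicator_of_notMem hu]
      positivity
  have hbi : ∀ Z : Ω → ℝ, Measurable Z → Integrable (fun ω => h (Z ω)) μ := by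
    intro Z hZ
    refine Integrable.of_bound (hhm.comp hZ).aestronglyMeasurable (M ^ 2) (Eventually.of_forall fun ω => ?_)
    rw [Real.norm_eq_abs, abs_of_nonneg (hh0 _)]
    exact hhb _
  have hbX := hbi _ hmeas
  have hbN : Integrable (fun ω => h (- X ω)) μ := hbi _ hmeas.neg
  have hpt : ∀ u, (tr M u) ^ 2 ≤ u0 ^ 2 + (h u + h (-u)) := by
    intro u
    have a1 := hh0 u
    have a2 := hh0 (-u)
    by_cases hu : u ∈ Set.Icc (-M) M
    · have e : tr M u = u := Set.indicator_of_mem (s := Set.Icc (-M) M) hu (id : ℝ → ℝ)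
      rw [e]
      rcases lt_or_ge u0 u with h1 | h1
      · have : h u = u ^ 2 := Set.indicator_of_mem (s := Set.Ioc u0 M) ⟨h1, hu.2⟩ _
        nlinarith [sq_nonneg u0]
      · rcases lt_or_ge u0 (-u) with h2 | h2
        · have : h (-u) = (-u) ^ 2 :=
            Set.indicator_of_mem (s := Set.Ioc u0 M) ⟨h2, by linarith [hu.1]⟩ _
          nlinarith [sq_nonneg u0]
        · nlinarith
    · have e : tr M u = 0 := Set.indicator_of_notMem (s := Set.Icc (-M) M) hu (id : ℝ → ℝ)
      rw [e]; nlinarith [sq_nonneg u0]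
  have hsym : ∫ ω, h (- X ω) ∂μ = ∫ ω, h (X ω) ∂μ := ((hs.comp hhm).integral_eq).symm
  have h1 : ∫ ω, (tr M (X ω)) ^ 2 ∂μ ≤ u0 ^ 2 + 2 * ∫ ω, h (X ω) ∂μ := by
    calc ∫ ω, (tr M (X ω)) ^ 2 ∂μ ≤ ∫ ω, (u0 ^ 2 + (h (X ω) + h (- X ω))) ∂μ := by
          refine integral_mono_of_nonneg (Eventually.of_forall fun ω => sq_nonneg _) ?_
            (Eventually.of_forall fun ω => hpt _)
          exact (integrable_const _).add (hbX.add hbN)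
      _ = u0 ^ 2 + 2 * ∫ ω, h (X ω) ∂μ := by
          have e1 : ∫ ω, (h (X ω) + h (- X ω)) ∂μ = 2 * ∫ ω, h (X ω) ∂μ := by
            rw [integral_add hbX hbN, hsym]; ring
          have e2 : Integrable (fun ω => h (X ω) + h (- X ω)) μ := hbX.add hbN
          rw [integral_add (integrable_const _) e2, e1]
          simp
  have h2 : ∫ ω, h (X ω) ∂μ = ∫ u, f u * h u := by
    rw [← integral_map (φ := X) (f := h) hmeas.aemeasurable hhm.aestronglyMeasurable, hpdf,
      integral_withDensity_eq_integral_toReal_smul (by fun_prop) (by simp)]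
    simp [ENNReal.toReal_ofReal (hf0 _)]
  have hii : IntervalIntegrable (fun u : ℝ => K0 * u ^ (1 - α)) volume u0 M :=
    (intervalIntegral.intervalIntegrable_rpow' (by linarith)).const_mul _
  have h3 : ∫ u, f u * h u ≤ ∫ u, Set.indicator (Set.Ioc u0 M) (fun u => K0 * u ^ (1 - α)) u := by
    refine integral_mono_of_nonneg (Eventually.of_forall fun u => mul_nonneg (hf0 u) (hh0 u)) ?_
      (Eventually.of_forall fun u => ?_)
    · rw [integrable_indicator_iff measurableSet_Ioc]
      exact (intervalIntegrable_iff_integrableOn_Ioc_of_le hM).1 hii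
    · by_cases hu : u ∈ Set.Ioc u0 M
      · have hup : 0 < u := hu0.trans hu.1
        simp only [h, Set.indicator_of_mem hu]
        calc f u * u ^ 2 ≤ (K0 * u ^ (-1 - α)) * u ^ 2 := by
              gcongr; exact htail u hu.1.le
          _ = K0 * u ^ (1 - α) := by
              rw [mul_assoc, ← Real.rpow_natCast u 2, ← Real.rpow_add hup]
              congr 2; push_cast; ring
      · simp only [h, Set.indicator_of_notMem hu]; simp
  have h4 : ∫ u, Set.indicator (Set.Ioc u0 M) (fun u => K0 * u ^ (1 - α)) u
      ≤ K0 / (2 - α) * M ^ (2 - α) := by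
    rw [integral_indicator measurableSet_Ioc, ← intervalIntegral.integral_of_le hM,
      intervalIntegral.integral_const_mul, integral_rpow (Or.inl (by linarith)),
      show 1 - α + 1 = 2 - α by ring]
    have : 0 < 2 - α := by linarith
    have : 0 ≤ u0 ^ (2 - α) := by positivity
    rw [div_mul_eq_mul_div, mul_div_assoc]
    gcongr
    linarith
  have h5 : u0 ^ 2 ≤ u0 ^ α * M ^ (2 - α) := by
    calc u0 ^ 2 = u0 ^ α * u0 ^ (2 - α) := by
          rw [← Real.rpow_natCast u0 2, ← Real.rpow_add hu0]
          congr 1; push_cast; ring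
      _ ≤ _ := by
          gcongr
  rw [h2] at h1
  nlinarith

end RemTerm

theorem remainder_term_small
    {Ω : Type*} [MeasureSpace Ω] [IsProbabilityMeasure (ℙ : Measure Ω)]
    (α : ℝ) (hα : α ∈ Set.Ioo (0 : ℝ) 2)
    (X : ℕ → Ω → ℝ) (hmeas : ∀ i, Measurable (X i))
    (hindep : iIndepFun X ℙ)
    (hident : ∀ i, IdentDistrib (X i) (X 0) ℙ ℙ)
    (hsymm : Measure.map (X 0) ℙ = Measure.map (fun ω => -(X 0 ω)) ℙ)
    (f : ℝ → ℝ) (hf0 : ∀ u, 0 ≤ f u) (hfmeas : Measurable f)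
    (hpdf : Measure.map (X 0) ℙ = (volume : Measure ℝ).withDensity (fun u => ENNReal.ofReal (f u)))
    (k0 K0 u0 : ℝ) (hk0 : 0 < k0) (hK0 : k0 ≤ K0) (hu0 : 0 < u0)
    (htail : ∀ u, u0 ≤ u → k0 * u ^ (-1 - α) ≤ f u ∧ f u ≤ K0 * u ^ (-1 - α))
    (n : ℕ → ℕ) (hn : ∀ k, 0 < n k)
    (x : ℕ → ℝ) (hx : ∀ k, 0 < x k)
    (c : ℕ → ℝ) (hc : ∀ k, c k ∈ Set.Ioo (0 : ℝ) 1)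
    (b : ℕ → ℝ) (hb : ∀ k, b k ∈ Set.Ioo (0 : ℝ) 1)
    (hLD : Tendsto (fun k => (n k : ℝ) / x k ^ α) atTop (nhds 0))
    (hcc : Tendsto (fun k => (n k : ℝ) * x k ^ (-α) / c k ^ (2 * α)) atTop (nhds 0))
    (hbb : Tendsto (fun k => (n k : ℝ) * x k ^ (-α) / (b k ^ 2 * c k ^ (α - 2))) atTop (nhds 0))
:
    Tendsto (fun k => (n k : ℝ) * (ℙ {ω | X 0 ω > x k ∧ |(∑ i ∈ Finset.range (n k), X i ω) - X 0 ω| > b k * x k ∧ ∀ j ∈ Finset.range (n k), j ≠ 0 → |X j ω| ≤ c k * x k}).toReal / (ℙ {ω | (∑ i ∈ Finset.range (n k), X i ω) > x k}).toReal) atTop (nhds 0) := by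
  have hα0 := hα.1
  have hα2 := hα.2
  have hK : 0 < K0 := hk0.trans_le hK0
  have htail' : ∀ u, u0 ≤ u → f u ≤ K0 * u ^ (-1 - α) := fun u hu => (htail u hu).2
  have hs0 : IdentDistrib (X 0) (fun ω => - X 0 ω) ℙ ℙ :=
    ⟨(hmeas 0).aemeasurable, (hmeas 0).neg.aemeasurable, hsymm⟩
  have hs : ∀ i, IdentDistrib (X i) (fun ω => - X i ω) ℙ ℙ := fun i =>
    (hident i).trans (hs0.trans ((hident i).symm.comp measurable_neg))
  set C : ℝ := u0 ^ α + 2 * (K0 / (2 - α)) with hC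
  -- the truncation level is eventually at least `u0`
  have hM : ∀ᶠ k in atTop, u0 ≤ c k * x k := by
    have hpos : 0 < u0 ^ (-α) := by positivity
    filter_upwards [hcc.eventually_lt_const hpos] with k hk
    have hck := (hc k).1
    have hck1 := (hc k).2
    have hxk := hx k
    have h1 : (c k * x k) ^ (-α) ≤ (n k : ℝ) * x k ^ (-α) / c k ^ (2 * α) := by
      rw [Real.mul_rpow hck.le hxk.le, mul_div_assoc, div_eq_mul_inv, ← Real.rpow_neg hck.le]
      have hn1 : (1 : ℝ) ≤ n k := by exact_mod_cast hn k
      have h2 : c k ^ (-α) ≤ c k ^ (-(2 * α)) :=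
        Real.rpow_le_rpow_of_exponent_ge hck hck1.le (by linarith)
      have h3 : 0 ≤ x k ^ (-α) := by positivity
      have h4 : 0 ≤ x k ^ (-α) * c k ^ (-(2 * α)) := by positivity
      nlinarith
    by_contra hlt
    push Not at hlt
    have := Real.rpow_le_rpow_of_nonpos (by positivity) hlt.le (by linarith : -α ≤ 0)
    linarith
  have hpn : ∀ᶠ k in atTop, K0 / α * ((n k : ℝ) / x k ^ α) < 1 / 4 := by
    have := hLD.const_mul (K0 / α)
    rw [mul_zero] at this
    exact this.eventually_lt_const (by norm_num)
  have hlim := hbb.const_mul (4 * C)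
  rw [mul_zero] at hlim
  refine squeeze_zero' (Eventually.of_forall fun k => by positivity) ?_ hlim
  filter_upwards [hM, hpn] with k hMk hpk
  have hck := (hc k).1
  have hck1 := (hc k).2
  have hxk := hx k
  have hbk := (hb k).1
  have hxu : u0 ≤ x k := hMk.trans (by nlinarith)
  set p : ℝ := (ℙ : Measure Ω).real {ω | X 0 ω > x k} with hp
  have hpi : ∀ i, (ℙ : Measure Ω).real {ω | X i ω > x k} = p := by
    intro i
    simp only [hp, Measure.real]
    congr 1
    exact (hident i).measure_mem_eq (s := Set.Ioi (x k)) measurableSet_Ioi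
  have hp0 : 0 ≤ p := by positivity
  have hlow := RemTerm.lower hmeas hindep hs (n k) (x k) p hpi
  have hple : p ≤ K0 / α * x k ^ (-α) :=
    RemTerm.tail_le (hmeas 0) hpdf hα0 hK hu0 htail' (x k) hxu
  have hnp : (n k : ℝ) * p ≤ 1 / 4 := by
    refine le_trans ?_ hpk.le
    calc (n k : ℝ) * p ≤ n k * (K0 / α * x k ^ (-α)) := by gcongr
      _ = _ := by rw [Real.rpow_neg hxk.le]; ring
  have hlow' : (n k : ℝ) * p / 4 ≤ (ℙ : Measure Ω).real {ω | ∑ i ∈ Finset.range (n k), X i ω > x k} := by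
    refine le_trans ?_ hlow
    have : 0 ≤ (n k : ℝ) * p := by positivity
    nlinarith
  -- numerator
  let T : Finset ℕ := (Finset.range (n k)).erase 0
  let B : Set (T → ℝ) := {v | |∑ i, v i| > b k * x k} ∩ {v | ∀ i, |v i| ≤ c k * x k}
  have hB : MeasurableSet B := by
    apply MeasurableSet.inter
    · exact measurableSet_lt measurable_const (by fun_prop)
    · rw [Set.ofPred_forall]
      exact MeasurableSet.iInter fun i => measurableSet_le (by fun_prop) measurable_const
  have hsumT : ∀ ω, ∑ i : T, X i ω = ∑ i ∈ T, X i ω := fun ω =>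
    Finset.sum_coe_sort T (fun i => X i ω)
  have hnum := RemTerm.indep_mul hmeas hindep 0 T (by simp [T]) (Set.Ioi (x k)) measurableSet_Ioi B hB
  have hset : {ω | X 0 ω > x k ∧ |(∑ i ∈ Finset.range (n k), X i ω) - X 0 ω| > b k * x k ∧ ∀ j ∈ Finset.range (n k), j ≠ 0 → |X j ω| ≤ c k * x k} = {ω | X 0 ω ∈ Set.Ioi (x k) ∧ (fun i : T => X i ω) ∈ B} := by
    ext ω
    have e : (∑ i ∈ Finset.range (n k), X i ω) - X 0 ω = ∑ i : T, X i ω := by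
      rw [hsumT, ← Finset.add_sum_erase (Finset.range (n k)) (fun i => X i ω) (Finset.mem_range.2 (hn k))]
      simp [T]
    change _ ∧ _ ∧ _ ↔ _ ∧ (|∑ i : T, X i ω| > b k * x k ∧ ∀ i : T, |X i ω| ≤ c k * x k)
    rw [e]
    simp only [Set.mem_Ioi, gt_iff_lt]
    refine and_congr_right fun _ => and_congr_right fun _ => ?_
    constructor
    · intro h i
      have := i.2
      simp only [T, Finset.mem_erase] at this
      exact h i this.2 this.1
    · intro h j hj hj0
      exact h ⟨j, by simp only [T, Finset.mem_erase]; exact ⟨hj0, hj⟩⟩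
  have hset2 : {ω | (fun i : T => X i ω) ∈ B} = {ω | |∑ i ∈ T, X i ω| > b k * x k ∧ ∀ i ∈ T, |X i ω| ≤ c k * x k} := by
    ext ω
    change (|∑ i : T, X i ω| > b k * x k ∧ ∀ i : T, |X i ω| ≤ c k * x k) ↔ (_ ∧ _)
    rw [hsumT]
    simp
  have hq := RemTerm.cheb hmeas hindep hident hs T (c k * x k) (b k * x k) (by positivity) (by positivity)
  rw [← hset2] at hq
  rw [hset]
  change (n k : ℝ) * (ℙ : Measure Ω).real _ / (ℙ : Measure Ω).real _ ≤ _
  rw [hnum]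
  set q := (ℙ : Measure Ω).real {ω | (fun i : T => X i ω) ∈ B} with hqdef
  have hp' : (ℙ : Measure Ω).real {ω | X 0 ω ∈ Set.Ioi (x k)} = p := rfl
  rw [hp']
  have hV := RemTerm.second_le (hmeas 0) hf0 hfmeas hs0 hpdf hα2 hK hu0 htail' (c k * x k) hMk
  rw [← hC] at hV
  have hCpos : 0 ≤ C := by
    have : 0 < 2 - α := by linarith
    positivity
  have hcard : (T.card : ℝ) ≤ n k := by
    have : T.card ≤ n k := Finset.card_erase_le.trans (by simp)
    exact_mod_cast this
  have hq2 : q ≤ C * ((n k : ℝ) * x k ^ (-α) / (b k ^ 2 * c k ^ (α - 2))) := by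
    calc q ≤ _ := hq
      _ ≤ n k * (C * (c k * x k) ^ (2 - α)) / (b k * x k) ^ 2 := by
          gcongr
      _ = _ := by
          have hxe : x k ^ (2 - α) = x k ^ 2 * x k ^ (-α) := by
            rw [sub_eq_add_neg, Real.rpow_add hxk, Real.rpow_two]
          rw [Real.mul_rpow hck.le hxk.le, show α - 2 = -(2 - α) by ring, Real.rpow_neg hck.le, hxe]
          have : c k ^ (2 - α) ≠ 0 := by positivity
          field_simp
  have hq0 : 0 ≤ q := by positivity
  refine div_le_of_le_mul₀ (by positivity) ?_ ?_
  · have : 0 ≤ (n k : ℝ) * x k ^ (-α) / (b k ^ 2 * c k ^ (α - 2)) := by positivity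
    positivity
  · set r := (n k : ℝ) * x k ^ (-α) / (b k ^ 2 * c k ^ (α - 2)) with hr
    have hr0 : 0 ≤ r := by positivity
    calc (n k : ℝ) * (p * q) = 4 * q * (n k * p / 4) := by ring
      _ ≤ 4 * (C * r) * (ℙ : Measure Ω).real {ω | ∑ i ∈ Finset.range (n k), X i ω > x k} := by
          gcongr
      _ = _ := by ring
end
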